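/- In PG(n,q), with n ≥ 3 and q = p^h a square prime power with q ≥ 4, every (n−1)-blocking set K of type (a,b,c)_{n-1} with a = C_{n−3,0} = θ_{n-2}, b = C_{n−4,2} = θ_{n-2} + (√q)^{2n−5} and c = C_{n−3,1} = θ_{n-2} + (√q)^{2n−3} is an (n−3,2)-Baer cone. -/

import Mathlib

open Module Set

noncomputable section

variable (F : Type) [Field F]

/-- The point set of `PG(n,q)`: the projectivization of `GF(q)^{n+1}`. -/
abbrev PGPoint (n : ℕ) := Projectivization F (Fin (n + 1) → F)

/-- The set of points of the projective space lying in (the projectivization of)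
a linear subspace `W`. A `d`-dimensional projective subspace corresponds to a
submodule `W` with `finrank F W = d + 1`; hyperplanes correspond to `finrank F W = n`. -/
def projSet (n : ℕ) (W : Submodule F (Fin (n + 1) → F)) : Set (PGPoint F n) :=
  {x | x.submodule ≤ W}

/-- `θ_m = (q^{m+1} - 1)/(q - 1)`, the number of points of `PG(m,q)`. -/
def theta (q m : ℕ) : ℕ := (q ^ (m + 1) - 1) / (q - 1)

/-- `K` is of type `(a,b,c)_{n-1}`: every hyperplane meets `K` in `a`, `b` or `c`
points, and each of the three values is attained by some hyperplane. -/
def IsType3 (n : ℕ) (K : Set (PGPoint F n)) (a b c : ℕ) : Prop :=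
  (∀ W : Submodule F (Fin (n + 1) → F), finrank F W = n →
      (K ∩ projSet F n W).ncard = a ∨ (K ∩ projSet F n W).ncard = b ∨
        (K ∩ projSet F n W).ncard = c) ∧
  (∃ W : Submodule F (Fin (n + 1) → F), finrank F W = n ∧ (K ∩ projSet F n W).ncard = a) ∧
  (∃ W : Submodule F (Fin (n + 1) → F), finrank F W = n ∧ (K ∩ projSet F n W).ncard = b) ∧
  (∃ W : Submodule F (Fin (n + 1) → F), finrank F W = n ∧ (K ∩ projSet F n W).ncard = c)

/-- `tnum K m`: the number of hyperplanes meeting `K` in exactly `m` points. -/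
def tnum (n : ℕ) (K : Set (PGPoint F n)) (m : ℕ) : ℕ :=
  {W : Submodule F (Fin (n + 1) → F) | finrank F W = n ∧ (K ∩ projSet F n W).ncard = m}.ncard

/-- `K` blocks every `t`-dimensional projective subspace of `PG(n,q)`,
i.e. `K` is an `(n-t)`-blocking set. -/
def BlocksDim (n t : ℕ) (K : Set (PGPoint F n)) : Prop :=
  ∀ W : Submodule F (Fin (n + 1) → F), finrank F W = t + 1 → (K ∩ projSet F n W).Nonempty

/-- `C_{vr-1, s} = ((√q)^{s+1}-1)/(√q-1) · q^{vr} + θ_{vr-1}`, the number of points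
of an `(vr-1, s)`-Baer cone; here `vr` is the linear rank of the vertex (projective
dimension of the vertex plus one), so that the convention `C_{-1,s}` corresponds
to `vr = 0`, and `sq` denotes `√q`. -/
def Cnum (q sq vr s : ℕ) : ℕ := (sq ^ (s + 1) - 1) / (sq - 1) * q ^ vr + (q ^ vr - 1) / (q - 1)

/-- `B` is an `s`-dimensional Baer subgeometry with respect to the subfield `F₀`
(of order `√q`): the set of points whose representative vectors are the nonzero
`F₀`-linear combinations of `s+1` vectors spanning an `(s+1)`-dimensional
`F`-subspace (equivalently, the nonzero vectors of an `(s+1)`-dimensional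
`F₀`-subspace whose `F`-span has `F`-dimension `s+1`). -/
def IsBaerSubgeo (n : ℕ) (F₀ : Subfield F) (s : ℕ) (B : Set (PGPoint F n)) : Prop :=
  ∃ v : Fin (s + 1) → (Fin (n + 1) → F),
    LinearIndependent F v ∧
    B = {x | ∃ (c : Fin (s + 1) → F) (_ : ∀ i, c i ∈ F₀) (hne : (∑ i, c i • v i) ≠ 0),
          x = Projectivization.mk F (∑ i, c i • v i) hne}

/-- `K` is an `(vr-1, s)`-Baer cone: there are a vertex subspace `Wv` of linear rank `vr`
and a complementary subspace `Wb` of linear rank `n+1-vr` disjoint from it such that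
`K ∩ Wb` is an `s`-dimensional Baer subgeometry and `K` is the union of the vertex,
the base, and all points on lines joining a point of the vertex to a point of the base. -/
def IsBaerCone (n : ℕ) (F₀ : Subfield F) (vr s : ℕ) (K : Set (PGPoint F n)) : Prop :=
  ∃ Wv Wb : Submodule F (Fin (n + 1) → F),
    finrank F Wv = vr ∧ finrank F Wb = n + 1 - vr ∧ Wv ⊓ Wb = ⊥ ∧
    IsBaerSubgeo F n F₀ s (K ∩ projSet F n Wb) ∧
    K = projSet F n Wv ∪ (K ∩ projSet F n Wb) ∪
      ⋃ y ∈ K ∩ projSet F n Wb, ⋃ x ∈ projSet F n Wv,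
        projSet F n (x.submodule ⊔ y.submodule)

namespace BaerCone

open scoped Classical LinearAlgebra.Projectivization

set_option linter.unusedSectionVars false

section Counting

variable {F : Type*} [Field F] [Fintype F] {U : Type*} [AddCommGroup U] [Module F U] [Fintype U]

lemma card_submodule (W : Submodule F U) :
    (Finset.univ.filter (fun v => v ∈ W)).card = Fintype.card F ^ finrank F W := by
  rw [← Fintype.card_subtype, ← Nat.card_eq_fintype_card, ← Nat.card_eq_fintype_card (α := F)]
  exact Module.natCard_eq_pow_finrank (K := F) (V := W)

lemma finrank_eq_of_card {W : Submodule F U} {d : ℕ}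
    (h : (Finset.univ.filter (fun v => v ∈ W)).card = Fintype.card F ^ d) : finrank F W = d := by
  rw [card_submodule] at h
  exact Nat.pow_right_injective Fintype.one_lt_card h

lemma card_cone_eq (S : Set (ℙ F U)) :
    (Finset.univ.filter (fun v : U => ∃ h : v ≠ 0, Projectivization.mk F v h ∈ S)).card =
      (Fintype.card F - 1) * S.ncard := by
  have : Fintype (ℙ F U) := Fintype.ofFinite _
  rw [← Fintype.card_units, Set.ncard_eq_toFinset_card', ← Finset.card_univ, ← Finset.card_product]
  symm
  have hmk (c : Fˣ) (x : ℙ F U) (hne : c • x.rep ≠ 0) : Projectivization.mk F _ hne = x := by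
    conv_rhs => rw [← x.mk_rep]
    exact (Projectivization.mk_eq_mk_iff F _ _ _ _).2 ⟨c, rfl⟩
  have hne (c : Fˣ) (x : ℙ F U) : c • x.rep ≠ 0 := (smul_ne_zero_iff_ne _).2 x.rep_nonzero
  refine Finset.card_bij (fun y _ => y.1 • y.2.rep) ?_ ?_ ?_
  · rintro ⟨c, x⟩ h
    simp only [Finset.mem_product, Finset.mem_univ, true_and, Set.mem_toFinset] at h
    simp only [Finset.mem_filter, Finset.mem_univ, true_and]
    exact ⟨hne c x, by rwa [hmk]⟩
  · rintro ⟨c, x⟩ _ ⟨d, y⟩ _ h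
    have hxy : x = y := by
      rw [← hmk c x (hne c x), ← hmk d y (hne d y)]
      congr 1
    subst hxy
    have h2 : (c : F) • x.rep = (d : F) • x.rep := h
    have := smul_left_injective F x.rep_nonzero h2
    simp [Units.ext this]
  · intro v hv
    simp only [Finset.mem_filter, Finset.mem_univ, true_and] at hv
    obtain ⟨h, hS⟩ := hv
    obtain ⟨a, ha⟩ := Projectivization.exists_smul_eq_mk_rep F v h
    exact ⟨(a⁻¹, Projectivization.mk F v h), by simpa using hS, by simp [← ha]⟩

lemma dvd_card_of_smul_mem (P : U → Prop) (h0 : ¬ P 0)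
    (hs : ∀ (c : F) v, c ≠ 0 → P v → P (c • v)) :
    (Fintype.card F - 1) ∣ (Finset.univ.filter P).card := by
  refine ⟨{x : ℙ F U | P x.rep}.ncard, ?_⟩
  rw [← card_cone_eq]
  congr 1
  ext v
  simp only [Finset.mem_filter, Finset.mem_univ, true_and, Set.mem_ofPred_eq]
  constructor
  · intro hv
    have h : v ≠ 0 := fun h => h0 (h ▸ hv)
    refine ⟨h, ?_⟩
    obtain ⟨a, ha⟩ := Projectivization.exists_smul_eq_mk_rep F v h
    rw [← ha]; exact hs a v a.ne_zero hv
  · rintro ⟨h, hv⟩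
    obtain ⟨a, ha⟩ := Projectivization.exists_smul_eq_mk_rep F v h
    have := hs (a⁻¹ : Fˣ) _ (Units.ne_zero _) hv
    rw [← ha] at this
    rwa [← Units.smul_def, inv_smul_smul] at this

lemma card_ker_mul {W : Submodule F U} (g : U →ₗ[F] F) (hg : ∃ w ∈ W, g w ≠ 0) :
    (Finset.univ.filter (fun v => v ∈ W ∧ g v = 0)).card * Fintype.card F =
      Fintype.card F ^ finrank F W := by
  have h1 : Finset.univ.filter (fun v => v ∈ W ∧ g v = 0) =
      Finset.univ.filter (fun v => v ∈ W ⊓ LinearMap.ker g) := by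
    ext v; simp
  rw [h1, card_submodule, ← pow_succ]
  congr 1
  obtain ⟨w, hw, hgw⟩ := hg
  have h2 := Module.Dual.finrank_ker_add_one_of_ne_zero (K := F) (f := g.domRestrict W) (by
    intro h; apply hgw; simpa using LinearMap.congr_fun h ⟨w, hw⟩)
  have h3 : (LinearMap.ker (g.domRestrict W)).map W.subtype = W ⊓ LinearMap.ker g := by
    ext v
    simp [and_comm]
  rw [← h2, ← h3,
    ← (Submodule.equivMapOfInjective W.subtype W.injective_subtype _).finrank_eq]

lemma card_preimage {U' : Type*} [AddCommGroup U'] [Module F U'] [Fintype U'] (f : U →ₗ[F] U')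
    (hf : Function.Surjective f) (P : U' → Prop) :
    (Finset.univ.filter (fun v => P (f v))).card =
      Fintype.card F ^ finrank F (LinearMap.ker f) * (Finset.univ.filter P).card := by
  rw [Finset.card_eq_sum_card_fiberwise (f := f) (t := Finset.univ.filter P)
    (fun v hv => by simpa using hv)]
  rw [mul_comm]
  apply Finset.sum_const_nat
  intro w hw
  obtain ⟨v, rfl⟩ := hf w
  rw [← card_submodule]
  refine Finset.card_bij (fun x _ => x - v) ?_ ?_ ?_
  · intro x hx
    simp only [Finset.mem_filter, Finset.mem_univ, true_and] at hx
    simp [hx.2]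
  · intro x _ y _ h
    exact sub_left_injective h
  · intro x hx
    simp only [Finset.mem_filter, Finset.mem_univ, true_and, LinearMap.mem_ker] at hx hw
    exact ⟨x + v, by simp [hx, hw], by simp⟩

end Counting

section Zeros

variable {F : Type*} [Field F] [Fintype F] {V : Type*} [AddCommGroup V] [Module F V] [Fintype V]

/-- The number of vectors of `X` on which the functional `φ` vanishes. -/
def zeros (X : Finset V) (φ : Dual F V) : ℕ := (X.filter (fun v => φ v = 0)).card

/-- The number of vectors of `X` in the subspace `L`. -/
def inCard (X : Finset V) (L : Submodule F V) : ℕ := (X.filter (fun v => v ∈ L)).card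

variable [Fintype (Dual F V)]

lemma sum_zeros (X : Finset V) (L : Submodule F V) (r : ℕ)
    (hr : finrank F V = finrank F L + r + 1) :
    (∑ φ ∈ Finset.univ.filter (fun φ : Dual F V => φ ∈ L.dualAnnihilator), (zeros X φ : ℤ)) =
      (Fintype.card F : ℤ) ^ (r + 1) * inCard X L +
        (Fintype.card F : ℤ) ^ r * (X.card - inCard X L) := by
  have hrank : finrank F L.dualAnnihilator = r + 1 := by
    have := Subspace.finrank_add_finrank_dualAnnihilator_eq L
    omega
  have h1 := Finset.sum_card_bipartiteAbove_eq_sum_card_bipartiteBelow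
    (s := Finset.univ.filter (fun φ : Dual F V => φ ∈ L.dualAnnihilator)) (t := X)
    (fun φ v => φ v = 0)
  have h2 : ∀ v ∈ X, ((Finset.univ.filter
      (fun φ : Dual F V => φ ∈ L.dualAnnihilator)).bipartiteBelow (fun φ v => φ v = 0) v).card =
      if v ∈ L then Fintype.card F ^ (r + 1) else Fintype.card F ^ r := by
    intro v _
    rw [Finset.bipartiteBelow, Finset.filter_filter]
    split_ifs with hv
    · rw [← hrank, ← card_submodule]
      congr 1
      ext φ
      simp only [Finset.mem_filter, Finset.mem_univ, true_and, and_iff_left_iff_imp]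
      intro h
      exact (Submodule.mem_dualAnnihilator φ).1 h v hv
    · have hex : ∃ φ ∈ L.dualAnnihilator, (Dual.eval F V v) φ ≠ 0 := by
        by_contra! hcon
        apply hv
        rw [← Subspace.dualAnnihilator_dualCoannihilator_eq (W := L),
          Submodule.mem_dualCoannihilator]
        exact hcon
      have := card_ker_mul (Dual.eval F V v) hex
      rw [hrank, pow_succ] at this
      exact Nat.eq_of_mul_eq_mul_right Fintype.card_pos this
  have h3 : (∑ φ ∈ Finset.univ.filter (fun φ : Dual F V => φ ∈ L.dualAnnihilator), zeros X φ) =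
      ∑ v ∈ X, if v ∈ L then Fintype.card F ^ (r + 1) else Fintype.card F ^ r := by
    rw [← Finset.sum_congr rfl h2, ← h1]
    rfl
  have h4 : inCard X L + (X.filter (fun v => ¬ v ∈ L)).card = X.card :=
    Finset.card_filter_add_card_filter_not _
  have h5 : ((X.filter (fun v => ¬ v ∈ L)).card : ℤ) = X.card - inCard X L := by
    rw [← h4]; push_cast; ring
  rw [← h5, ← Nat.cast_sum, h3, Finset.sum_ite, Finset.sum_const, Finset.sum_const, inCard]
  push_cast
  simp only [nsmul_eq_mul]
  push_cast
  ring

lemma sum_zeros_sq (X : Finset V) (h0 : (0 : V) ∈ X) (hs : ∀ (c : F), ∀ v ∈ X, c • v ∈ X)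
    (m : ℕ) (hm : finrank F V = m + 2) :
    (∑ φ : Dual F V, (zeros X φ : ℤ) ^ 2) =
      (Fintype.card F : ℤ) ^ (m + 2) + (Fintype.card F : ℤ) ^ (m + 1) * (X.card - 1) +
      (X.card - 1) * ((Fintype.card F : ℤ) ^ (m + 1) * Fintype.card F +
        (Fintype.card F : ℤ) ^ m * (X.card - Fintype.card F)) := by
  have h1 : (∑ φ : Dual F V, (zeros X φ : ℤ) ^ 2) =
      ∑ v ∈ X, ∑ φ ∈ Finset.univ.filter
        (fun φ : Dual F V => φ ∈ (F ∙ v).dualAnnihilator), (zeros X φ : ℤ) := by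
    have : ∀ φ : Dual F V, (zeros X φ : ℤ) ^ 2 =
        ∑ v ∈ X, if φ v = 0 then (zeros X φ : ℤ) else 0 := by
      intro φ
      rw [← Finset.sum_filter, Finset.sum_const, nsmul_eq_mul, sq]
      rfl
    simp_rw [this]
    rw [Finset.sum_comm]
    refine Finset.sum_congr rfl fun v _ => ?_
    rw [Finset.sum_filter]
    refine Finset.sum_congr rfl fun φ _ => ?_
    have : φ ∈ (F ∙ v).dualAnnihilator ↔ φ v = 0 := by
      rw [Submodule.mem_dualAnnihilator]
      constructor
      · intro h; exact h v (Submodule.mem_span_singleton_self v)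
      · intro h w hw
        obtain ⟨c, rfl⟩ := Submodule.mem_span_singleton.1 hw
        simp [h]
    simp only [this]
  have h2 : ∀ v ∈ X.erase 0, ∑ φ ∈ Finset.univ.filter
        (fun φ : Dual F V => φ ∈ (F ∙ v).dualAnnihilator), (zeros X φ : ℤ) =
      (Fintype.card F : ℤ) ^ (m + 1) * Fintype.card F +
        (Fintype.card F : ℤ) ^ m * (X.card - Fintype.card F) := by
    intro v hv
    have hne := Finset.ne_of_mem_erase hv
    have hr : finrank F (F ∙ v) = 1 := finrank_span_singleton hne
    rw [sum_zeros X (F ∙ v) m (by omega)]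
    have : inCard X (F ∙ v) = Fintype.card F := by
      have h := card_submodule (F ∙ v)
      rw [hr, pow_one] at h
      rw [← h, inCard]
      congr 1
      ext w
      simp only [Finset.mem_filter, Finset.mem_univ, true_and, and_iff_right_iff_imp]
      intro hw
      obtain ⟨c, rfl⟩ := Submodule.mem_span_singleton.1 hw
      exact hs c v (Finset.mem_of_mem_erase hv)
    rw [this]
  rw [h1, ← Finset.add_sum_erase _ _ h0, Finset.sum_congr rfl h2, Finset.sum_const,
    Finset.card_erase_of_mem h0, nsmul_eq_mul, Nat.cast_pred (Finset.card_pos.2 ⟨0, h0⟩)]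
  have hr : finrank F (F ∙ (0 : V)) = 0 := by simp
  rw [sum_zeros X (F ∙ (0 : V)) (m + 1) (by omega)]
  have : inCard X (F ∙ (0 : V)) = 1 := by
    rw [inCard, Finset.card_eq_one]
    refine ⟨0, ?_⟩
    ext w
    simp only [Submodule.span_zero_singleton, Submodule.mem_bot, Finset.mem_filter,
      Finset.mem_singleton, and_iff_right_iff_imp]
    rintro rfl; exact h0
  rw [this]
  push_cast
  ring

lemma sum_zeros_univ (X : Finset V) (h0 : (0 : V) ∈ X) (m : ℕ) (hm : finrank F V = m + 1) :
    (∑ φ : Dual F V, (zeros X φ : ℤ)) =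
      (Fintype.card F : ℤ) ^ (m + 1) + (Fintype.card F : ℤ) ^ m * (X.card - 1) := by
  have := sum_zeros X (⊥ : Submodule F V) m (by simpa using hm)
  have h1 : inCard X (⊥ : Submodule F V) = 1 := by
    rw [inCard, Finset.card_eq_one]
    refine ⟨0, ?_⟩
    ext w
    simp only [Submodule.mem_bot, Finset.mem_filter,
      Finset.mem_singleton, and_iff_right_iff_imp]
    rintro rfl; exact h0
  rw [h1] at this
  simpa using this

end Zeros

section Arithmetic

lemma first_moment {s u Y δ S₁ : ℤ} (hs : 2 ≤ s) (hu : 0 < u)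
    (hY : Y = u * s ^ 5 + (s ^ 2 - 1) * u * δ)
    (h : Y + u * s ^ 3 * (u * s ^ 7 - 1) + (s ^ 2 - 1) * u * S₁ = u * s ^ 7 + u * s ^ 5 * (Y - 1)) :
    S₁ = δ * (u * s ^ 5 - 1) + (s ^ 2 - 1) * s ^ 3 := by
  have h1 : (s ^ 2 - 1) * u ≠ 0 := by
    have : 0 < s ^ 2 - 1 := by nlinarith
    positivity
  apply mul_left_cancel₀ h1
  subst hY
  linear_combination h

lemma second_moment {s u Y δ S₁ S₂ : ℤ} (hs : 2 ≤ s) (hu : 0 < u)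
    (hY : Y = u * s ^ 5 + (s ^ 2 - 1) * u * δ)
    (h₁ : S₁ = δ * (u * s ^ 5 - 1) + (s ^ 2 - 1) * s ^ 3)
    (h : Y ^ 2 + (u * s ^ 3) ^ 2 * (u * s ^ 7 - 1) + 2 * (u * s ^ 3) * ((s ^ 2 - 1) * u) * S₁
      + ((s ^ 2 - 1) * u) ^ 2 * S₂ =
      u * s ^ 7 + u * s ^ 5 * (Y - 1) +
        (Y - 1) * (u * s ^ 5 * s ^ 2 + u * s ^ 3 * (Y - s ^ 2))) :
    S₂ = (s ^ 2 - 1) * (s ^ 6 + δ * s ^ 3) + δ ^ 2 * (u * s ^ 3 - 1) := by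
  have h1 : ((s ^ 2 - 1) * u) ^ 2 ≠ 0 := by
    have : 0 < s ^ 2 - 1 := by nlinarith
    positivity
  apply mul_left_cancel₀ h1
  subst hY h₁
  linear_combination h

lemma prime_pow_dvd_or {p m : ℕ} (hp : p.Prime) {δ : ℤ} (h : (p : ℤ) ^ m ∣ δ * (δ - 1)) :
    (p : ℤ) ^ m ∣ δ ∨ (p : ℤ) ^ m ∣ δ - 1 := by
  have hp' : Prime (p : ℤ) := Nat.prime_iff_prime_int.1 hp
  by_cases hd : (p : ℤ) ∣ δ
  · left
    have h1 : ¬ (p : ℤ) ∣ δ - 1 := fun h2 => hp'.not_isUnit (isUnit_of_dvd_one (by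
      have := dvd_sub hd h2; simpa using this))
    exact IsCoprime.dvd_of_dvd_mul_right
      (IsCoprime.pow_left ((Prime.coprime_iff_not_dvd hp').2 h1)) h
  · right
    exact IsCoprime.dvd_of_dvd_mul_left
      (IsCoprime.pow_left ((Prime.coprime_iff_not_dvd hp').2 hd)) h

/-- The arithmetic of the standard equations: the excess `δ` of a set with the three
given intersection numbers is `q = s ^ 2`. -/
lemma excess_eq {s u δ A B C x y : ℤ} (hs : 2 ≤ s) (hu : u = s ∨ s ^ 3 ≤ u)
    (hdvd : s ^ 2 ∣ δ * (δ - 1) → s ^ 2 ∣ δ ∨ s ^ 2 ∣ δ - 1)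
    (hδ : 0 ≤ δ) (hA : 1 ≤ A)
    (hS₁ : (s ^ 2 - 1) * (B + s ^ 2 * C) = δ * (u * s ^ 5 - 1) + (s ^ 2 - 1) * s ^ 3)
    (hS₂ : (s ^ 2 - 1) * (B + s ^ 4 * C) =
      (s ^ 2 - 1) * (s ^ 6 + δ * s ^ 3) + δ ^ 2 * (u * s ^ 3 - 1))
    (hS₀ : (s ^ 2 - 1) * (A + B + C) = u * s ^ 7 - 1)
    (hx : 0 ≤ x) (hy : 0 ≤ y) (hxy : x + y ≤ s ^ 2) (hm : x + s ^ 2 * y = s ^ 3 + δ)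
    (hC : δ < s ^ 2 → C = y) : δ = s ^ 2 := by
  have hq1 : 0 < s ^ 2 - 1 := by nlinarith
  have hτc : s ^ 2 * (s ^ 2 - 1) ^ 2 * C = (s ^ 2 - 1) * (s ^ 6 + δ * s ^ 3) +
      δ ^ 2 * (u * s ^ 3 - 1) - δ * (u * s ^ 5 - 1) - (s ^ 2 - 1) * s ^ 3 := by
    linear_combination hS₂ - hS₁
  have hτa : s ^ 2 * (s ^ 2 - 1) * A = (u * s ^ 3 - 1) * (δ - s ^ 2) * (δ - s ^ 4) +
      (s ^ 2 - 1) * (s ^ 6 + s ^ 4 + s ^ 2 + δ * s ^ 3 - (s ^ 2 + 1) * (δ + s ^ 3)) := by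
    linear_combination hS₂ - (s ^ 2 + 1) * hS₁ + s ^ 2 * hS₀
  rcases lt_trichotomy δ (s ^ 2) with hlt | heq | hgt
  · exfalso
    have hδ01 : δ = 0 ∨ δ = 1 := by
      have h1 : s ^ 2 ∣ δ * (δ - 1) := by
        refine ⟨(s ^ 2 - 1) ^ 2 * C * (-1) + (s ^ 2 - 1) * (s ^ 4 + δ * s - s) + δ ^ 2 * u * s -
          δ * u * s ^ 3, ?_⟩
        linear_combination hτc
      rcases hdvd h1 with h | h
      · left; exact Int.eq_zero_of_dvd_of_nonneg_of_lt hδ hlt h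
      · rcases hδ.eq_or_lt with h0 | h0
        · left; exact h0.symm
        · right
          have := Int.eq_zero_of_dvd_of_nonneg_of_lt (by omega) (by omega) h
          omega
    have hys : y = s := by
      have h1 : s ^ 2 * y ≤ s ^ 2 * s + 1 := by
        rcases hδ01 with h | h <;> nlinarith
      have h2 : y ≤ s := by nlinarith
      have h3 : s ^ 2 * (s - y) ≤ s ^ 2 - y := by nlinarith
      by_contra hne
      have h4 : y + 1 ≤ s := by omega
      have h5 : s ^ 2 * (s - y - 1) + y ≤ 0 := by linarith
      have h6 : 0 ≤ s ^ 2 * (s - y - 1) := by apply mul_nonneg <;> nlinarith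
      have : y = 0 := by linarith
      subst this
      nlinarith
    rw [hC hlt, hys] at hτc
    rcases hδ01 with h | h
    · subst h
      have h7 : (s ^ 2 - 1) * (s ^ 2 * s ^ 3 * (s - 1)) = 0 := by linear_combination -hτc
      have : 0 < (s ^ 2 - 1) * (s ^ 2 * s ^ 3 * (s - 1)) := by
        have : 0 < s - 1 := by omega
        positivity
      omega
    · subst h
      have h7 : (s ^ 2 - 1) * (s ^ 3 * (u - s ^ 3) + s ^ 3 * (s ^ 2 - 1)) = 0 := by
        linear_combination hτc
      rcases hu with hu | hu
      · subst hu
        have h8 : (u ^ 2 - 1) * u ^ 3 * ((u - 1) * (u ^ 2 - 1)) = 0 := by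
          linear_combination -h7
        have : 0 < (u ^ 2 - 1) * u ^ 3 * ((u - 1) * (u ^ 2 - 1)) := by
          have : 0 < u - 1 := by omega
          positivity
        omega
      · have h9 : 0 < s ^ 3 * (u - s ^ 3) + s ^ 3 * (s ^ 2 - 1) := by
          have : 0 ≤ u - s ^ 3 := by omega
          positivity
        have := mul_pos hq1 h9
        omega
  · exact heq
  · exfalso
    have hs3 : 0 < s ^ 3 := by positivity
    have hub : δ ≤ s ^ 4 - s ^ 3 := by nlinarith
    have hus : s ≤ u := by
      rcases hu with h | h
      · exact h.ge
      · nlinarith [mul_pos hq1 (by omega : 0 < s)]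
    have hQ : 0 ≤ s ^ 3 * (u - s) := by
      have : 0 ≤ u - s := by omega
      positivity
    have hneg : 0 < (δ - s ^ 2) * (s ^ 4 - δ) := by
      apply mul_pos <;> omega
    have hkey : s ^ 2 * (s ^ 2 - 1) * A + s ^ 3 * (u - s) * ((δ - s ^ 2) * (s ^ 4 - δ)) =
        (s ^ 2 - 1) * (s ^ 2 + (δ - s ^ 2 - 1) * ((s ^ 2 + 1) * δ - s ^ 6 - s ^ 4 + s ^ 3)) := by
      linear_combination hτa
    have hle : s ^ 2 * (s ^ 2 - 1) ≤ s ^ 2 * (s ^ 2 - 1) * A := by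
      have : 0 < s ^ 2 * (s ^ 2 - 1) := by positivity
      exact le_mul_of_one_le_right this.le hA
    have hneg2 : (s ^ 2 + 1) * δ - s ^ 6 - s ^ 4 + s ^ 3 < 0 := by
      have h5 : 0 < s ^ 5 := by positivity
      have h6 : (s ^ 2 + 1) * δ ≤ (s ^ 2 + 1) * (s ^ 4 - s ^ 3) :=
        mul_le_mul_of_nonneg_left hub (by positivity)
      linarith
    have hge : 0 ≤ s ^ 3 * (u - s) * ((δ - s ^ 2) * (s ^ 4 - δ)) :=
      mul_nonneg hQ hneg.le
    have hδ1 : δ = s ^ 2 + 1 := by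
      by_contra hne
      have h1 : 0 < δ - s ^ 2 - 1 := by omega
      have h2 := mul_neg_of_pos_of_neg hq1 (mul_neg_of_pos_of_neg h1 hneg2)
      linarith
    subst hδ1
    have hu' : u = s := by
      have h1 : s ^ 3 * (u - s) * ((s ^ 2 + 1 - s ^ 2) * (s ^ 4 - (s ^ 2 + 1))) ≤ 0 := by
        linarith
      have h2 : s ^ 3 * (u - s) = 0 := by
        by_contra hne
        have h3 : 0 < s ^ 3 * (u - s) := lt_of_le_of_ne hQ (Ne.symm hne)
        have := mul_pos h3 hneg
        omega
      rcases mul_eq_zero.1 h2 with h | h <;> omega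
    rw [hu'] at hτc
    have h10 : s ^ 2 * (s ^ 2 - 1) * ((s ^ 2 - 1) * C) =
        s ^ 2 * (s ^ 2 - 1) * (s ^ 4 + s ^ 3 + s ^ 2 + 1) := by linear_combination hτc
    have h11 := mul_left_cancel₀ (by positivity) h10
    have h12 : (s ^ 2 - 1) ∣ s + 3 := ⟨C - (s ^ 2 + s + 2), by linear_combination -h11⟩
    have h13 := Int.le_of_dvd (by omega) h12
    have h14 : s = 2 := by
      by_contra hne
      have h3 : 3 ≤ s := by omega
      have h15 : 3 * s ≤ s ^ 2 := by
        rw [sq]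
        exact mul_le_mul_of_nonneg_right h3 (by omega)
      linarith
    subst h14
    norm_num at h12

end Arithmetic

section Blocking

variable {F : Type*} [Field F] [Fintype F] {U : Type*} [AddCommGroup U] [Module F U] [Fintype U]

/-- Projection of a line-blocking set from a point `R` outside of it is onto. -/
lemma image_mkQ_eq_univ {Y : Finset U} (h0 : (0 : U) ∈ Y) (hs : ∀ (c : F), ∀ v ∈ Y, c • v ∈ Y)
    (hb : ∀ W : Submodule F U, finrank F W = 2 → ∃ v ∈ W, v ≠ 0 ∧ v ∈ Y) {R : U} (hR : R ∉ Y)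
    [Fintype (U ⧸ (F ∙ R))] : Y.image (F ∙ R).mkQ = Finset.univ := by
  rw [Finset.eq_univ_iff_forall]
  intro x
  obtain ⟨w, rfl⟩ := (F ∙ R).mkQ_surjective x
  rw [Finset.mem_image]
  have hR0 : R ≠ 0 := by rintro rfl; exact hR h0
  by_cases hw : w ∈ F ∙ R
  · exact ⟨0, h0, by rw [map_zero, eq_comm]; simpa using hw⟩
  · have hli : LinearIndependent F ![R, w] := by
      rw [LinearIndependent.pair_iff' hR0]
      intro a ha
      exact hw (Submodule.mem_span_singleton.2 ⟨a, ha⟩)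
    obtain ⟨v, hv, hv0, hvY⟩ := hb (Submodule.span F {R, w}) (by
      rw [← Matrix.range_cons_cons_empty R w ![], finrank_span_eq_card hli, Fintype.card_fin])
    obtain ⟨α, β, rfl⟩ := Submodule.mem_span_pair.1 hv
    have hβ : β ≠ 0 := by
      rintro rfl
      have hα : α ≠ 0 := by rintro rfl; simp at hv0
      apply hR
      have := hs α⁻¹ _ hvY
      simpa [smul_smul, hα] using this
    refine ⟨β⁻¹ • (α • R + β • w), hs _ _ hvY, ?_⟩
    rw [← sub_eq_zero, ← map_sub, Submodule.mkQ_apply, Submodule.Quotient.mk_eq_zero,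
      Submodule.mem_span_singleton]
    refine ⟨β⁻¹ * α, ?_⟩
    rw [smul_add, smul_smul, smul_smul, inv_mul_cancel₀ hβ, one_smul, add_sub_cancel_right]

lemma card_quotient_span {R : U} (hR : R ≠ 0) {m : ℕ} (hm : finrank F U = m + 1)
    [Fintype (U ⧸ (F ∙ R))] : Fintype.card (U ⧸ (F ∙ R)) = Fintype.card F ^ m := by
  have h1 := (F ∙ R).finrank_quotient_add_finrank
  rw [finrank_span_singleton hR, hm] at h1
  rw [Module.card_eq_pow_finrank (K := F)]
  congr 1
  omega

lemma le_card_of_blocking {Y : Finset U} (h0 : (0 : U) ∈ Y) (hs : ∀ (c : F), ∀ v ∈ Y, c • v ∈ Y)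
    (hb : ∀ W : Submodule F U, finrank F W = 2 → ∃ v ∈ W, v ≠ 0 ∧ v ∈ Y) {m : ℕ}
    (hm : finrank F U = m + 1) : Fintype.card F ^ m ≤ Y.card := by
  by_cases hR : ∃ R, R ∉ Y
  · obtain ⟨R, hR⟩ := hR
    have : Fintype (U ⧸ (F ∙ R)) := Fintype.ofFinite _
    have hR0 : R ≠ 0 := by rintro rfl; exact hR h0
    rw [← card_quotient_span hR0 hm, ← Finset.card_univ, ← image_mkQ_eq_univ h0 hs hb hR]
    exact Finset.card_image_le
  · push Not at hR
    rw [Finset.eq_univ_iff_forall.2 hR, Finset.card_univ,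
      Module.card_eq_pow_finrank (K := F) (V := U), hm]
    exact Nat.pow_le_pow_right Fintype.card_pos (Nat.le_succ m)

/-- The equality case of the Bose–Burton bound. -/
lemma add_mem_of_blocking {Y : Finset U} (h0 : (0 : U) ∈ Y)
    (hs : ∀ (c : F), ∀ v ∈ Y, c • v ∈ Y)
    (hb : ∀ W : Submodule F U, finrank F W = 2 → ∃ v ∈ W, v ≠ 0 ∧ v ∈ Y) {m : ℕ}
    (hm : finrank F U = m + 1) (hY : Y.card = Fintype.card F ^ m) {a b : U} (ha : a ∈ Y)
    (hab : b ∈ Y) : a + b ∈ Y := by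
  by_contra hR
  have : Fintype (U ⧸ (F ∙ (a + b))) := Fintype.ofFinite _
  have hR0 : a + b ≠ 0 := by intro h; exact hR (h ▸ h0)
  have hinj : Set.InjOn (F ∙ (a + b)).mkQ Y := by
    rw [← Finset.card_image_iff, image_mkQ_eq_univ h0 hs hb hR, Finset.card_univ,
      card_quotient_span hR0 hm, hY]
  have hnb : -b ∈ Y := by simpa using hs (-1) b hab
  have h1 : a = -b := by
    apply hinj ha hnb
    rw [← sub_eq_zero, ← map_sub, Submodule.mkQ_apply, Submodule.Quotient.mk_eq_zero,
      sub_neg_eq_add]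
    exact Submodule.mem_span_singleton_self _
  exact hR0 (by rw [h1]; simp)

end Blocking

section Main

variable {F : Type*} [Field F] [Fintype F] {V : Type*} [AddCommGroup V] [Module F V] [Fintype V]
  [Fintype (Dual F V)]

/-- A scalar-closed set `X` of vectors of a `(k + 4)`-dimensional space over `GF(s ^ 2)` meeting
every plane nontrivially, such that the intersection of `X` with the kernel of a nonzero
functional `φ` exceeds a hyperplane of that kernel by `(s ^ 2 - 1) * s ^ (2 * k + 1) * f φ` vectors,
where `f φ` is `0`, `1` or `s ^ 2`. -/
structure ThreeType (F : Type*) [Field F] [Fintype F] {V : Type*} [AddCommGroup V] [Module F V]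
    (X : Finset V) (f : Dual F V → ℤ) (s k : ℕ) : Prop where
  card_field : Fintype.card F = s ^ 2
  two_le : 2 ≤ s
  finrank_eq : finrank F V = k + 4
  zero_mem : (0 : V) ∈ X
  smul_mem : ∀ (c : F), ∀ v ∈ X, c • v ∈ X
  blocking : ∀ W : Submodule F V, finrank F W = 2 → ∃ v ∈ W, v ≠ 0 ∧ v ∈ X
  zeros_eq : ∀ φ : Dual F V, φ ≠ 0 →
    (zeros X φ : ℤ) = (s : ℤ) ^ (2 * k + 4) + ((s : ℤ) ^ 2 - 1) * (s : ℤ) ^ (2 * k + 1) * f φ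
  values : ∀ φ : Dual F V, φ ≠ 0 → f φ = 0 ∨ f φ = 1 ∨ f φ = (s : ℤ) ^ 2

/-- The number of nonzero functionals of type `t` in `M`. -/
def cnt (f : Dual F V → ℤ) (M : Submodule F (Dual F V)) (t : ℤ) : ℕ :=
  (Finset.univ.filter (fun φ : Dual F V => φ ∈ M ∧ φ ≠ 0 ∧ f φ = t)).card

namespace ThreeType

variable {X : Finset V} {f : Dual F V → ℤ} {s k : ℕ} (h : ThreeType F X f s k)
include h

lemma card_field_int : (Fintype.card F : ℤ) = (s : ℤ) ^ 2 := by
  rw [h.card_field]; push_cast; rfl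

lemma two_le_int : (2 : ℤ) ≤ s := by exact_mod_cast h.two_le

lemma sq_sub_one_pos : (0 : ℤ) < (s : ℤ) ^ 2 - 1 := by nlinarith [h.two_le_int]

lemma weight_pos : (0 : ℤ) < (s : ℤ) ^ (2 * k + 1) := by
  have := h.two_le_int
  positivity

lemma f_smul {c : F} (hc : c ≠ 0) {φ : Dual F V} (hφ : φ ≠ 0) : f (c • φ) = f φ := by
  have h1 := h.zeros_eq φ hφ
  have h2 := h.zeros_eq (c • φ) (smul_ne_zero hc hφ)
  have h3 : zeros X (c • φ) = zeros X φ := by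
    simp [zeros, hc]
  rw [h3, h1] at h2
  have h4 : ((s : ℤ) ^ 2 - 1) * (s : ℤ) ^ (2 * k + 1) ≠ 0 :=
    (mul_pos h.sq_sub_one_pos h.weight_pos).ne'
  exact (mul_left_cancel₀ h4 (add_left_cancel h2)).symm

lemma exists_cnt_eq (M : Submodule F (Dual F V)) (t : ℤ) :
    ∃ x : ℕ, (cnt f M t : ℤ) = ((s : ℤ) ^ 2 - 1) * x := by
  obtain ⟨x, hx⟩ := dvd_card_of_smul_mem (F := F)
    (fun φ : Dual F V => φ ∈ M ∧ φ ≠ 0 ∧ f φ = t) (by simp) (by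
      rintro c φ hc ⟨h1, h2, h3⟩
      exact ⟨M.smul_mem c h1, smul_ne_zero hc h2, (h.f_smul hc h2).trans h3⟩)
  refine ⟨x, ?_⟩
  have hc : cnt f M t = (Fintype.card F - 1) * x := by
    rw [← hx, cnt]
    congr
  rw [hc, Nat.cast_mul, Nat.cast_pred Fintype.card_pos, h.card_field_int]

lemma sum_comp (M : Submodule F (Dual F V)) (g : ℤ → ℤ) :
    ∑ φ ∈ Finset.univ.filter (fun φ : Dual F V => φ ∈ M ∧ φ ≠ 0), g (f φ) =
      g 0 * cnt f M 0 + g 1 * cnt f M 1 + g ((s : ℤ) ^ 2) * cnt f M ((s : ℤ) ^ 2) := by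
  have hs := h.sq_sub_one_pos
  have h1 : ∀ φ ∈ Finset.univ.filter (fun φ : Dual F V => φ ∈ M ∧ φ ≠ 0), g (f φ) =
      (if f φ = 0 then g 0 else 0) + (if f φ = 1 then g 1 else 0) +
        (if f φ = (s : ℤ) ^ 2 then g ((s : ℤ) ^ 2) else 0) := by
    intro φ hφ
    simp only [Finset.mem_filter, Finset.mem_univ, true_and] at hφ
    have h2 : (1 : ℤ) ≠ (s : ℤ) ^ 2 := by omega
    have h3 : (0 : ℤ) ≠ (s : ℤ) ^ 2 := by omega
    rcases h.values φ hφ.2 with h4 | h4 | h4 <;> simp [h4, h2, h3, h2.symm, h3.symm]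
  have h5 : ∀ t : ℤ, ∑ φ ∈ Finset.univ.filter (fun φ : Dual F V => φ ∈ M ∧ φ ≠ 0),
      (if f φ = t then g t else 0) = g t * cnt f M t := by
    intro t
    rw [← Finset.sum_filter, Finset.filter_filter, Finset.sum_const, nsmul_eq_mul, mul_comm, cnt]
    simp only [and_assoc]
  rw [Finset.sum_congr rfl h1, Finset.sum_add_distrib, Finset.sum_add_distrib, h5, h5, h5]

lemma sum_erase_zero (M : Submodule F (Dual F V)) (g : Dual F V → ℤ) :
    ∑ φ ∈ Finset.univ.filter (fun φ : Dual F V => φ ∈ M), g φ =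
      g 0 + ∑ φ ∈ Finset.univ.filter (fun φ : Dual F V => φ ∈ M ∧ φ ≠ 0), g φ := by
  rw [← Finset.add_sum_erase _ _ (a := 0) (by simp)]
  congr 2
  ext φ
  simp [and_comm]

lemma cnt_add (M : Submodule F (Dual F V)) :
    (cnt f M 0 : ℤ) + cnt f M 1 + cnt f M ((s : ℤ) ^ 2) = ((s : ℤ) ^ 2) ^ finrank F M - 1 := by
  have h1 := h.sum_comp M (fun _ => 1)
  have h2 := h.sum_erase_zero M (fun _ => 1)
  rw [Finset.sum_const, card_submodule] at h2
  simp only [nsmul_eq_mul, mul_one, Nat.cast_pow, h.card_field_int] at h2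
  simp only [one_mul] at h1
  linarith

lemma zeros_zero : zeros X (0 : Dual F V) = X.card := by
  simp [zeros]

/-- The sum of the types of the hyperplanes through a subspace of codimension two. -/
lemma pencil (L : Submodule F V) (hL : finrank F L = k + 2) :
    (s : ℤ) ^ (2 * k + 1) * (cnt f L.dualAnnihilator 1 +
        (s : ℤ) ^ 2 * cnt f L.dualAnnihilator ((s : ℤ) ^ 2)) =
      (s : ℤ) ^ 2 * inCard X L + X.card - ((s : ℤ) ^ 2 + 1) * (s : ℤ) ^ (2 * k + 4) := by
  have hV := h.finrank_eq
  have h1 := sum_zeros X L 1 (by omega)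
  have hM : finrank F L.dualAnnihilator = 2 := by
    have := Subspace.finrank_add_finrank_dualAnnihilator_eq L
    omega
  have h3 := h.sum_comp L.dualAnnihilator
    (fun t => (s : ℤ) ^ (2 * k + 4) + ((s : ℤ) ^ 2 - 1) * (s : ℤ) ^ (2 * k + 1) * t)
  have h4 := h.cnt_add L.dualAnnihilator
  rw [hM] at h4
  rw [h.sum_erase_zero, h.zeros_zero, h.card_field_int, Finset.sum_congr rfl (fun φ hφ =>
    h.zeros_eq φ (Finset.mem_filter.1 hφ).2.2), h3] at h1
  apply mul_left_cancel₀ h.sq_sub_one_pos.ne'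
  linear_combination h1 - (s : ℤ) ^ (2 * k + 4) * h4

lemma moments {δ : ℤ} (hδ : (X.card : ℤ) = (s : ℤ) ^ (2 * k + 1) * (s : ℤ) ^ 5 +
      ((s : ℤ) ^ 2 - 1) * (s : ℤ) ^ (2 * k + 1) * δ) :
    (cnt f ⊤ 1 : ℤ) + (s : ℤ) ^ 2 * cnt f ⊤ ((s : ℤ) ^ 2) =
        δ * ((s : ℤ) ^ (2 * k + 1) * (s : ℤ) ^ 5 - 1) + ((s : ℤ) ^ 2 - 1) * (s : ℤ) ^ 3 ∧
      (cnt f ⊤ 1 : ℤ) + (s : ℤ) ^ 4 * cnt f ⊤ ((s : ℤ) ^ 2) =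
        ((s : ℤ) ^ 2 - 1) * ((s : ℤ) ^ 6 + δ * (s : ℤ) ^ 3) +
          δ ^ 2 * ((s : ℤ) ^ (2 * k + 1) * (s : ℤ) ^ 3 - 1) := by
  have hV := h.finrank_eq
  have h1 := sum_zeros_univ (F := F) X h.zero_mem (k + 3) (by omega)
  have h2 := sum_zeros_sq (F := F) X h.zero_mem h.smul_mem (k + 2) (by omega)
  have h3 := h.sum_comp ⊤
    (fun t => (s : ℤ) ^ (2 * k + 4) + ((s : ℤ) ^ 2 - 1) * (s : ℤ) ^ (2 * k + 1) * t)
  have h3' := h.sum_comp ⊤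
    (fun t => ((s : ℤ) ^ (2 * k + 4) + ((s : ℤ) ^ 2 - 1) * (s : ℤ) ^ (2 * k + 1) * t) ^ 2)
  have h4 := h.cnt_add ⊤
  rw [finrank_top, Subspace.dual_finrank_eq, hV] at h4
  have h5 := h.sum_erase_zero ⊤ (fun φ => (zeros X φ : ℤ))
  have h6 := h.sum_erase_zero ⊤ (fun φ => (zeros X φ : ℤ) ^ 2)
  have h7 := Finset.sum_congr (rfl : Finset.univ.filter (fun φ : Dual F V =>
    φ ∈ (⊤ : Submodule F (Dual F V)) ∧ φ ≠ 0) = _) (fun φ hφ =>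
      h.zeros_eq φ (Finset.mem_filter.1 hφ).2.2)
  have h8 := Finset.sum_congr (rfl : Finset.univ.filter (fun φ : Dual F V =>
    φ ∈ (⊤ : Submodule F (Dual F V)) ∧ φ ≠ 0) = _) (fun φ hφ => congrArg (· ^ 2)
      (h.zeros_eq φ (Finset.mem_filter.1 hφ).2.2))
  rw [h.zeros_zero, h7, h3] at h5
  rw [h.zeros_zero, h8, h3'] at h6
  simp only [Submodule.mem_top, Finset.filter_true] at h5 h6
  rw [h1, h.card_field_int] at h5
  rw [h2, h.card_field_int] at h6
  have hS₁ := first_moment h.two_le_int h.weight_pos hδ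
    (S₁ := (cnt f ⊤ 1 : ℤ) + (s : ℤ) ^ 2 * cnt f ⊤ ((s : ℤ) ^ 2))
    (by linear_combination -h5 - (s : ℤ) ^ (2 * k + 4) * h4)
  refine ⟨hS₁, second_moment h.two_le_int h.weight_pos hδ hS₁ ?_⟩
  linear_combination -h6 - (s : ℤ) ^ (4 * k + 8) * h4

/-- Equality in the Bose–Burton bound: in a hyperplane of type `0` the set is a subspace. -/
lemma exists_subspace {φ : Dual F V} (hφ : φ ≠ 0) (h0 : f φ = 0) :
    ∃ S : Submodule F V, finrank F S = k + 2 ∧ ∀ v, v ∈ S ↔ v ∈ X ∧ φ v = 0 := by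
  have hker : finrank F (LinearMap.ker φ) = k + 2 + 1 := by
    have := Module.Dual.finrank_ker_add_one_of_ne_zero hφ
    have := h.finrank_eq
    omega
  have hz : zeros X φ = Fintype.card F ^ (k + 2) := by
    have := h.zeros_eq φ hφ
    rw [h0, mul_zero, add_zero] at this
    rw [h.card_field, ← pow_mul]
    have h2 : 2 * (k + 2) = 2 * k + 4 := by ring
    rw [h2]
    exact_mod_cast this
  let Y : Finset (LinearMap.ker φ) := Finset.univ.filter (fun v => (v : V) ∈ X)
  have hY : Y.card = Fintype.card F ^ (k + 2) := by
    rw [← hz, zeros]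
    refine Finset.card_bij (fun v _ => (v : V)) ?_ ?_ ?_
    · intro v hv
      simpa [Y] using hv
    · intro v _ w _ hvw
      exact Subtype.ext hvw
    · intro v hv
      simp only [Finset.mem_filter] at hv
      exact ⟨⟨v, hv.2⟩, by simpa [Y] using hv.1, rfl⟩
  have hadd {a b : LinearMap.ker φ} (ha : a ∈ Y) (hb : b ∈ Y) : a + b ∈ Y := by
    refine add_mem_of_blocking (F := F) (by simpa [Y] using h.zero_mem) ?_ ?_ hker hY ha hb
    · intro c v hv
      simp only [Y, Finset.mem_filter, Finset.mem_univ, true_and] at hv ⊢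
      exact h.smul_mem c v hv
    · intro W hW
      obtain ⟨v, hv, hv0, hvX⟩ := h.blocking (W.map (LinearMap.ker φ).subtype) (by
        rw [← hW]
        exact (Submodule.equivMapOfInjective _ (Submodule.injective_subtype _) W).finrank_eq.symm)
      obtain ⟨w, hw, rfl⟩ := hv
      exact ⟨w, hw, fun hw0 => hv0 (by simp [hw0]), by simpa [Y] using hvX⟩
  let S : Submodule F V :=
    { carrier := {v | v ∈ X ∧ φ v = 0}
      add_mem' := by
        rintro a b ⟨ha, ha'⟩ ⟨hb, hb'⟩
        have := hadd (a := ⟨a, ha'⟩) (b := ⟨b, hb'⟩) (by simpa [Y] using ha) (by simpa [Y] using hb)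
        exact ⟨by simpa [Y] using this, by rw [map_add, ha', hb', add_zero]⟩
      zero_mem' := ⟨h.zero_mem, map_zero φ⟩
      smul_mem' := by
        rintro c v ⟨hv, hv'⟩
        exact ⟨h.smul_mem c v hv, by rw [map_smul, hv', smul_zero]⟩ }
  refine ⟨S, finrank_eq_of_card ?_, fun v => Iff.rfl⟩
  rw [← hz, zeros]
  congr 1
  ext v
  simp only [Finset.mem_filter, Finset.mem_univ, true_and]
  rfl

end ThreeType
end Main

lemma finrank_span_pair {F U : Type*} [Field F] [AddCommGroup U] [Module F U] {a b : U}
    (ha : a ≠ 0) (hb : b ∉ F ∙ a) : finrank F (Submodule.span F {a, b}) = 2 := by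
  have hli : LinearIndependent F ![a, b] := by
    rw [LinearIndependent.pair_iff' ha]
    intro c hc
    exact hb (Submodule.mem_span_singleton.2 ⟨c, hc⟩)
  rw [← Matrix.range_cons_cons_empty a b ![], finrank_span_eq_card hli, Fintype.card_fin]

section Main

variable {F : Type*} [Field F] [Fintype F] {V : Type*} [AddCommGroup V] [Module F V] [Fintype V]
  [Fintype (Dual F V)]

/-- `S` is the set of vectors of `X` in the kernel of the nonzero functional `φ` of type `0`. -/
structure IsTrace (X : Finset V) (f : Dual F V → ℤ) (k : ℕ) (φ : Dual F V) (S : Submodule F V) :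
    Prop where
  ne_zero : φ ≠ 0
  type_eq : f φ = 0
  finrank_eq : finrank F S = k + 2
  mem_iff : ∀ v, v ∈ S ↔ v ∈ X ∧ φ v = 0

lemma IsTrace.mem_dualAnnihilator {X : Finset V} {f : Dual F V → ℤ} {k : ℕ} {φ : Dual F V}
    {S : Submodule F V} (hS : IsTrace X f k φ S) : φ ∈ S.dualAnnihilator := by
  rw [Submodule.mem_dualAnnihilator]
  intro v hv
  exact ((hS.mem_iff v).1 hv).2

lemma cnt_mono {f : Dual F V → ℤ} {M N : Submodule F (Dual F V)} (hMN : M ≤ N) (t : ℤ) :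
    cnt f M t ≤ cnt f N t := by
  refine Finset.card_le_card fun φ hφ => ?_
  simp only [Finset.mem_filter, Finset.mem_univ, true_and] at hφ ⊢
  exact ⟨hMN hφ.1, hφ.2⟩

namespace ThreeType

variable {X : Finset V} {f : Dual F V → ℤ} {s k : ℕ} (h : ThreeType F X f s k)
include h

lemma exists_isTrace {φ : Dual F V} (hφ : φ ≠ 0) (h0 : f φ = 0) : ∃ S, IsTrace X f k φ S := by
  obtain ⟨S, hS, hmem⟩ := h.exists_subspace hφ h0
  exact ⟨S, hφ, h0, hS, hmem⟩

lemma inCard_isTrace {φ : Dual F V} {S : Submodule F V} (hS : IsTrace X f k φ S) :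
    inCard X S = s ^ (2 * k + 4) := by
  have h1 := card_submodule S
  rw [hS.finrank_eq, h.card_field, ← pow_mul] at h1
  have h2 : 2 * k + 4 = 2 * (k + 2) := by ring
  rw [h2, ← h1, inCard]
  congr 1
  ext v
  simp only [Finset.mem_filter, Finset.mem_univ, true_and, and_iff_right_iff_imp]
  exact fun hv => ((hS.mem_iff v).1 hv).1

lemma le_cnt {M : Submodule F (Dual F V)} {φ : Dual F V} (hφM : φ ∈ M) (hφ : φ ≠ 0) :
    (s : ℤ) ^ 2 - 1 ≤ cnt f M (f φ) := by
  obtain ⟨x, hx⟩ := h.exists_cnt_eq M (f φ)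
  have hpos : 0 < cnt f M (f φ) := Finset.card_pos.2 ⟨φ, by simp [hφM, hφ]⟩
  have h1 := h.sq_sub_one_pos
  have h2 : 0 < x := by
    rcases Nat.eq_zero_or_pos x with rfl | hx0
    · simp at hx; omega
    · exact hx0
  rw [hx]
  have : (1 : ℤ) ≤ x := by exact_mod_cast h2
  nlinarith

lemma exists_cnt_isTrace {φ : Dual F V} {S : Submodule F V} (hS : IsTrace X f k φ S) :
    ∃ x y : ℕ, (cnt f S.dualAnnihilator 1 : ℤ) = ((s : ℤ) ^ 2 - 1) * x ∧
      (cnt f S.dualAnnihilator ((s : ℤ) ^ 2) : ℤ) = ((s : ℤ) ^ 2 - 1) * y ∧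
      (x : ℤ) + y ≤ (s : ℤ) ^ 2 ∧
      (X.card : ℤ) = (s : ℤ) ^ (2 * k + 1) * (s : ℤ) ^ 5 +
        ((s : ℤ) ^ 2 - 1) * (s : ℤ) ^ (2 * k + 1) * (x + (s : ℤ) ^ 2 * y - (s : ℤ) ^ 3) := by
  obtain ⟨x, hx⟩ := h.exists_cnt_eq S.dualAnnihilator 1
  obtain ⟨y, hy⟩ := h.exists_cnt_eq S.dualAnnihilator ((s : ℤ) ^ 2)
  have h1 := h.pencil S hS.finrank_eq
  have h2 := h.cnt_add S.dualAnnihilator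
  have h3 := h.le_cnt hS.mem_dualAnnihilator hS.ne_zero
  have h4 : finrank F S.dualAnnihilator = 2 := by
    have := Subspace.finrank_add_finrank_dualAnnihilator_eq S
    have := h.finrank_eq
    have := hS.finrank_eq
    omega
  rw [hS.type_eq] at h3
  rw [h4, hx, hy] at h2
  rw [hx, hy, h.inCard_isTrace hS] at h1
  push_cast at h1
  refine ⟨x, y, hx, hy, ?_, ?_⟩
  · have := h.sq_sub_one_pos
    nlinarith
  · linear_combination -h1

lemma pencil_span {M : Submodule F (Dual F V)} (hM : finrank F M = 2) :
    (s : ℤ) ^ (2 * k + 1) * (cnt f M 1 + (s : ℤ) ^ 2 * cnt f M ((s : ℤ) ^ 2)) =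
      (s : ℤ) ^ 2 * inCard X M.dualCoannihilator + X.card -
        ((s : ℤ) ^ 2 + 1) * (s : ℤ) ^ (2 * k + 4) := by
  have h1 := Subspace.finrank_add_finrank_dualCoannihilator_eq M
  have h2 := h.finrank_eq
  have h3 := h.pencil M.dualCoannihilator (by omega)
  rwa [Subspace.dualCoannihilator_dualAnnihilator_eq] at h3

/-- A pencil containing a hyperplane of type `0`, but not based on its trace. -/
lemma pencil_isTrace {φ : Dual F V} {S : Submodule F V} (hS : IsTrace X f k φ S)
    {ψ : Dual F V} (hψ : ψ ∉ S.dualAnnihilator) {δ : ℤ}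
    (hδ : (X.card : ℤ) = (s : ℤ) ^ (2 * k + 1) * (s : ℤ) ^ 5 +
        ((s : ℤ) ^ 2 - 1) * (s : ℤ) ^ (2 * k + 1) * δ) :
    (cnt f (Submodule.span F {φ, ψ}) 1 : ℤ) +
      (s : ℤ) ^ 2 * cnt f (Submodule.span F {φ, ψ}) ((s : ℤ) ^ 2) = ((s : ℤ) ^ 2 - 1) * δ := by
  have hψ' : ψ ∉ F ∙ φ := fun hc => hψ ((Submodule.span_singleton_le_iff_mem _ _).2
    hS.mem_dualAnnihilator hc)
  have h1 := h.pencil_span (finrank_span_pair hS.ne_zero hψ')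
  have h2 : ∃ w ∈ S, ψ w ≠ 0 := by
    by_contra! hcon
    exact hψ ((Submodule.mem_dualAnnihilator ψ).2 hcon)
  have h3 := card_ker_mul ψ h2
  have h4 : inCard X (Submodule.span F {φ, ψ}).dualCoannihilator =
      (Finset.univ.filter (fun v => v ∈ S ∧ ψ v = 0)).card := by
    rw [inCard]
    congr 1
    ext v
    simp only [Finset.mem_filter, Finset.mem_univ, true_and, hS.mem_iff, and_assoc,
      and_congr_right_iff, Submodule.mem_dualCoannihilator]
    intro _
    constructor
    · intro hv
      exact ⟨hv φ (Submodule.subset_span (by simp)), hv ψ (Submodule.subset_span (by simp))⟩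
    · rintro ⟨hv1, hv2⟩ χ hχ
      obtain ⟨α, β, rfl⟩ := Submodule.mem_span_pair.1 hχ
      simp [hv1, hv2]
  rw [← h4, hS.finrank_eq] at h3
  have h5 : (inCard X (Submodule.span F {φ, ψ}).dualCoannihilator : ℤ) * (s : ℤ) ^ 2 =
      ((s : ℤ) ^ 2) ^ (k + 2) := by
    rw [← h.card_field_int]; exact_mod_cast h3
  apply mul_left_cancel₀ h.weight_pos.ne'
  linear_combination h1 + h5 + hδ

lemma card_eq {φ : Dual F V} (hφ : φ ≠ 0) (h0 : f φ = 0) :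
    (X.card : ℤ) = (s : ℤ) ^ (2 * k + 1) * (s : ℤ) ^ 5 +
        ((s : ℤ) ^ 2 - 1) * (s : ℤ) ^ (2 * k + 1) * (s : ℤ) ^ 2 := by
  obtain ⟨S, hS⟩ := h.exists_isTrace hφ h0
  obtain ⟨x, y, hx, hy, hxy, hY⟩ := h.exists_cnt_isTrace hS
  have hq := h.sq_sub_one_pos
  have hu := h.weight_pos
  obtain ⟨δ, hδ⟩ : ∃ δ : ℤ, δ = x + (s : ℤ) ^ 2 * y - (s : ℤ) ^ 3 := ⟨_, rfl⟩
  rw [← hδ] at hY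
  obtain ⟨hS₁, hS₂⟩ := h.moments hY
  obtain ⟨A, hA⟩ := h.exists_cnt_eq ⊤ 0
  obtain ⟨B, hB⟩ := h.exists_cnt_eq ⊤ 1
  obtain ⟨C, hC⟩ := h.exists_cnt_eq ⊤ ((s : ℤ) ^ 2)
  have hS₀ := h.cnt_add ⊤
  rw [finrank_top, Subspace.dual_finrank_eq, h.finrank_eq] at hS₀
  rw [hB, hC] at hS₁ hS₂
  rw [hA, hB, hC] at hS₀
  have hA1 := h.le_cnt (M := ⊤) Submodule.mem_top hφ
  rw [h0, hA] at hA1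
  have hδ0 : 0 ≤ δ := by
    have h1 := le_card_of_blocking (F := F) h.zero_mem h.smul_mem h.blocking h.finrank_eq
    have h2 : ((s : ℤ) ^ 2) ^ (k + 3) ≤ X.card := by
      rw [← h.card_field_int]; exact_mod_cast h1
    have h3 : 0 ≤ ((s : ℤ) ^ 2 - 1) * (s : ℤ) ^ (2 * k + 1) * δ := by
      rw [hY] at h2
      have : ((s : ℤ) ^ 2) ^ (k + 3) = (s : ℤ) ^ (2 * k + 1) * (s : ℤ) ^ 5 := by ring
      linarith
    exact nonneg_of_mul_nonneg_right h3 (mul_pos hq hu)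
  have hδq : δ = (s : ℤ) ^ 2 := by
    refine excess_eq (u := (s : ℤ) ^ (2 * k + 1)) (A := A) (B := B) (C := C) (x := x) (y := y)
      h.two_le_int ?_ ?_ hδ0 ?_ ?_ ?_ ?_ (by positivity) (by positivity) hxy ?_ ?_
    · rcases Nat.eq_zero_or_pos k with rfl | hk
      · left; simp
      · right
        exact pow_le_pow_right₀ (by have := h.two_le_int; omega) (by omega)
    · obtain ⟨p, m, hp, hm⟩ : ∃ (p m : ℕ), p.Prime ∧ s ^ 2 = p ^ m := by
        obtain ⟨p, _⟩ := CharP.exists F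
        obtain ⟨m, hp, hm⟩ := FiniteField.card F p
        exact ⟨p, m, hp, by rw [← h.card_field, hm]⟩
      have hm' : (s : ℤ) ^ 2 = (p : ℤ) ^ m := by exact_mod_cast hm
      rw [hm']
      exact prime_pow_dvd_or hp
    · have : 0 < ((s : ℤ) ^ 2 - 1) * A := by linarith
      have := pos_of_mul_pos_right this hq.le
      omega
    · linear_combination hS₁
    · linear_combination hS₂
    · linear_combination hS₀
    · linear_combination -hδ
    · intro hlt
      have h1 : cnt f ⊤ ((s : ℤ) ^ 2) = cnt f S.dualAnnihilator ((s : ℤ) ^ 2) := by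
        apply le_antisymm _ (cnt_mono le_top _)
        refine Finset.card_le_card fun ψ hψ => ?_
        simp only [Finset.mem_filter, Finset.mem_univ, true_and, Submodule.mem_top] at hψ ⊢
        refine ⟨?_, hψ⟩
        by_contra hcon
        have h2 := h.pencil_isTrace hS hcon hY
        have h3 := h.le_cnt (M := Submodule.span F {φ, ψ}) (φ := ψ)
          (Submodule.subset_span (by simp)) hψ.1
        rw [hψ.2] at h3
        have h4 : (0 : ℤ) ≤ cnt f (Submodule.span F {φ, ψ}) 1 := by positivity
        nlinarith
      have h2 : ((s : ℤ) ^ 2 - 1) * C = ((s : ℤ) ^ 2 - 1) * y := by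
        rw [← hC, ← hy, h1]
      exact mul_left_cancel₀ hq.ne' h2
  rw [hY, hδq]

end ThreeType
end Main

section Main

variable {F : Type*} [Field F] [Fintype F] {V : Type*} [AddCommGroup V] [Module F V] [Fintype V]
  [Fintype (Dual F V)]

namespace ThreeType

variable {X : Finset V} {f : Dual F V → ℤ} {s k : ℕ} (h : ThreeType F X f s k)
include h

lemma cnt_top {φ : Dual F V} (hφ : φ ≠ 0) (h0 : f φ = 0) :
    (cnt f ⊤ 0 : ℤ) = ((s : ℤ) ^ 2 - 1) * ((s : ℤ) ^ 4 - s) ∧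
      (cnt f ⊤ ((s : ℤ) ^ 2) : ℤ) = ((s : ℤ) ^ 2 - 1) * ((s : ℤ) ^ 2 + s + 1) := by
  obtain ⟨hS₁, hS₂⟩ := h.moments (h.card_eq hφ h0)
  have hS₀ := h.cnt_add ⊤
  rw [finrank_top, Subspace.dual_finrank_eq, h.finrank_eq] at hS₀
  have hq := h.sq_sub_one_pos
  have hs : (0 : ℤ) < (s : ℤ) ^ 2 := by omega
  have hC : (cnt f ⊤ ((s : ℤ) ^ 2) : ℤ) = ((s : ℤ) ^ 2 - 1) * ((s : ℤ) ^ 2 + s + 1) := by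
    apply mul_left_cancel₀ (mul_pos hs hq).ne'
    linear_combination hS₂ - hS₁
  refine ⟨?_, hC⟩
  linear_combination hS₀ - hS₁ + ((s : ℤ) ^ 2 - 1) * hC

lemma ne_one_of_mem_dualAnnihilator {φ : Dual F V} {S : Submodule F V} (hS : IsTrace X f k φ S)
    {ψ : Dual F V} (hψS : ψ ∈ S.dualAnnihilator) (hψ : ψ ≠ 0) : f ψ ≠ 1 := by
  obtain ⟨x, y, hx, hy, hxy, hY⟩ := h.exists_cnt_isTrace hS
  rw [h.card_eq hS.ne_zero hS.type_eq] at hY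
  have hq := h.sq_sub_one_pos
  have hs := h.two_le_int
  have h1 : (x : ℤ) + (s : ℤ) ^ 2 * y = (s : ℤ) ^ 2 * (s + 1) := by
    have := mul_left_cancel₀ (mul_pos hq h.weight_pos).ne' (add_left_cancel hY)
    linear_combination -this
  obtain ⟨z, hz⟩ : (s : ℤ) ^ 2 ∣ x := ⟨s + 1 - y, by linear_combination h1⟩
  have h2 : z + y = s + 1 := by
    apply mul_left_cancel₀ (by omega : (s : ℤ) ^ 2 ≠ 0)
    linear_combination h1 - hz
  have h3 : z ≤ 0 := by
    by_contra! hc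
    have : (s : ℤ) ^ 2 * 1 ≤ (s : ℤ) ^ 2 * z := by gcongr; omega
    have hz1 : z = 1 := by
      apply le_antisymm _ hc
      have : (s : ℤ) ^ 2 * z ≤ (s : ℤ) ^ 2 * 1 := by
        have : (0 : ℤ) ≤ y := by positivity
        linarith
      exact le_of_mul_le_mul_left this (by omega)
    rw [hz1] at h2 hz
    omega
  have h4 : (x : ℤ) ≤ 0 := by rw [hz]; nlinarith
  intro hcon
  have h5 := h.le_cnt hψS hψ
  rw [hcon, hx] at h5
  nlinarith

lemma mem_span_of_cnt_le {M : Submodule F (Dual F V)} {φ ψ : Dual F V} (hφM : φ ∈ M)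
    (hφ : φ ≠ 0) (hψM : ψ ∈ M) (hψ : ψ ≠ 0) (hf : f ψ = f φ)
    (hM : (cnt f M (f φ) : ℤ) ≤ (s : ℤ) ^ 2 - 1) : ψ ∈ F ∙ φ := by
  let A : Finset (Dual F V) := (Finset.univ.filter (fun χ => χ ∈ F ∙ φ)).erase 0
  have hA : (A.card : ℤ) = (s : ℤ) ^ 2 - 1 := by
    have h1 : A.card = Fintype.card F ^ 1 - 1 := by
      rw [Finset.card_erase_of_mem (by simp), card_submodule, finrank_span_singleton hφ]
    rw [h1, pow_one, Nat.cast_pred Fintype.card_pos, h.card_field_int]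
  have hsub : A ⊆ Finset.univ.filter (fun χ : Dual F V => χ ∈ M ∧ χ ≠ 0 ∧ f χ = f φ) := by
    intro χ hχ
    simp only [A, Finset.mem_erase, Finset.mem_filter, Finset.mem_univ, true_and] at hχ ⊢
    obtain ⟨hχ0, hχ⟩ := hχ
    obtain ⟨c, rfl⟩ := Submodule.mem_span_singleton.1 hχ
    have hc : c ≠ 0 := by rintro rfl; simp at hχ0
    exact ⟨M.smul_mem c hφM, hχ0, h.f_smul hc hφ⟩
  have heq := Finset.eq_of_subset_of_card_le hsub (by
    rw [← hA] at hM; exact_mod_cast hM)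
  have hψA : ψ ∈ A := by
    rw [heq]; simp [hψM, hψ, hf]
  simp only [A, Finset.mem_erase, Finset.mem_filter, Finset.mem_univ, true_and] at hψA
  exact hψA.2

lemma ne_one_of_mem_span_pair {φ : Dual F V} (hφ : φ ≠ 0) (h0 : f φ = 0) {ψ : Dual F V}
    (hψ : ψ ≠ 0 → f ψ ≠ 1) {χ : Dual F V} (hχ : χ ∈ Submodule.span F {φ, ψ}) (hχ0 : χ ≠ 0) :
    f χ ≠ 1 := by
  obtain ⟨S, hS⟩ := h.exists_isTrace hφ h0
  have hq := h.sq_sub_one_pos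
  by_cases hψS : ψ ∈ S.dualAnnihilator
  · refine h.ne_one_of_mem_dualAnnihilator hS ?_ hχ0
    refine Submodule.span_le.2 ?_ hχ
    rintro _ (rfl | rfl)
    · exact hS.mem_dualAnnihilator
    · exact hψS
  · have hψ0 : ψ ≠ 0 := by rintro rfl; exact hψS (Submodule.zero_mem _)
    have hψφ : ψ ∉ F ∙ φ := fun hc => hψS ((Submodule.span_singleton_le_iff_mem _ _).2
      hS.mem_dualAnnihilator hc)
    have h1 := h.pencil_isTrace hS hψS (h.card_eq hφ h0)
    have h2 := h.cnt_add (Submodule.span F {φ, ψ})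
    rw [finrank_span_pair hφ hψφ] at h2
    have hφM : φ ∈ Submodule.span F {φ, ψ} := Submodule.subset_span (by simp)
    have hψM : ψ ∈ Submodule.span F {φ, ψ} := Submodule.subset_span (by simp)
    generalize Submodule.span F {φ, ψ} = M at *
    obtain ⟨y, hy⟩ := h.exists_cnt_eq M ((s : ℤ) ^ 2)
    have hpos : (0 : ℤ) ≤ cnt f M 1 := by positivity
    have hzero : (cnt f M 1 : ℤ) ≤ 0 := by
      rcases Nat.eq_zero_or_pos y with rfl | hy1
      · exfalso
        rw [hy] at h1 h2
        rcases h.values ψ hψ0 with h3 | h3 | h3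
        · refine hψφ (h.mem_span_of_cnt_le hφM hφ hψM hψ0 (h3.trans h0.symm) ?_)
          rw [h0]
          push_cast at h1 h2
          nlinarith
        · exact hψ hψ0 h3
        · have := h.le_cnt hψM hψ0
          rw [h3, hy] at this
          push_cast at this
          linarith
      · have : (1 : ℤ) ≤ y := by exact_mod_cast hy1
        rw [hy] at h1
        have h4 : (s : ℤ) ^ 2 * (((s : ℤ) ^ 2 - 1) * 1) ≤
            (s : ℤ) ^ 2 * (((s : ℤ) ^ 2 - 1) * y) := by
          gcongr
        linarith
    intro hcon
    have := h.le_cnt hχ hχ0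
    rw [hcon] at this
    linarith

lemma card_ne_one {φ : Dual F V} (hφ : φ ≠ 0) (h0 : f φ = 0) :
    (Finset.univ.filter (fun ψ : Dual F V => ψ ≠ 0 → f ψ ≠ 1)).card = Fintype.card F ^ 3 := by
  have h1 := h.sum_comp ⊤ (fun t => if t = 1 then 0 else 1)
  have h2 : (s : ℤ) ^ 2 ≠ 1 := by have := h.sq_sub_one_pos; omega
  obtain ⟨ha, hc⟩ := h.cnt_top hφ h0
  have h3 : ∑ ψ ∈ Finset.univ.filter
      (fun ψ : Dual F V => ψ ∈ (⊤ : Submodule F (Dual F V)) ∧ ψ ≠ 0),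
      (if f ψ = 1 then (0 : ℤ) else 1) + 1 =
      (Finset.univ.filter (fun ψ : Dual F V => ψ ≠ 0 → f ψ ≠ 1)).card := by
    have h4 : (0 : Dual F V) ∈ Finset.univ.filter (fun ψ : Dual F V => ψ ≠ 0 → f ψ ≠ 1) := by simp
    rw [← Finset.card_erase_add_one h4]
    push_cast
    congr 1
    simp_rw [← ite_not (p := f _ = 1)]
    rw [← Finset.sum_filter, Finset.sum_const, nsmul_eq_mul, mul_one, Finset.filter_filter]
    congr 2
    ext ψ
    simp only [Finset.mem_filter, Finset.mem_erase, Finset.mem_univ, Submodule.mem_top, true_and]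
    tauto
  rw [h1] at h3
  simp only [h2, if_true, if_false, one_mul, zero_mul, zero_ne_one] at h3
  have h5 : ((Finset.univ.filter (fun ψ : Dual F V => ψ ≠ 0 → f ψ ≠ 1)).card : ℤ) =
      (Fintype.card F : ℤ) ^ 3 := by
    rw [← h3, ha, hc, h.card_field_int]
    ring
  exact_mod_cast h5

/-- The hyperplanes of types `0` and `s ^ 2` are those through a subspace of codimension three. -/
lemma exists_dual_plane {φ : Dual F V} (hφ : φ ≠ 0) (h0 : f φ = 0) :
    ∃ P : Submodule F (Dual F V), finrank F P = 3 ∧ ∀ ψ, ψ ∈ P ↔ (ψ ≠ 0 → f ψ ≠ 1) := by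
  have hcard := h.card_ne_one hφ h0
  have hs := h.two_le_int
  obtain ⟨ha, -⟩ := h.cnt_top hφ h0
  obtain ⟨φ', hφ', h0', hφφ'⟩ : ∃ φ' : Dual F V, φ' ≠ 0 ∧ f φ' = 0 ∧ φ' ∉ F ∙ φ := by
    by_contra! hcon
    have hle : cnt f ⊤ 0 ≤ cnt f (F ∙ φ) 0 := by
      refine Finset.card_le_card fun ψ hψ => ?_
      simp only [Finset.mem_filter, Finset.mem_univ, true_and] at hψ ⊢
      exact ⟨hcon ψ hψ.2.1 hψ.2.2, hψ.2⟩
    have h1 := h.cnt_add (F ∙ φ)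
    rw [finrank_span_singleton hφ] at h1
    have h2 : (cnt f ⊤ 0 : ℤ) ≤ cnt f (F ∙ φ) 0 := by exact_mod_cast hle
    rw [ha] at h2
    have h3 := h.sq_sub_one_pos
    have h4 : ((s : ℤ) ^ 2 - 1) * 2 ≤ ((s : ℤ) ^ 2 - 1) * ((s : ℤ) ^ 4 - s) := by
      gcongr
      nlinarith [sq_nonneg ((s : ℤ) ^ 2 - 1)]
    have h5 : (0 : ℤ) ≤ cnt f (F ∙ φ) 1 := by positivity
    have h6 : (0 : ℤ) ≤ cnt f (F ∙ φ) ((s : ℤ) ^ 2) := by positivity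
    linarith
  obtain ⟨ψ, hψ, hψM⟩ : ∃ ψ : Dual F V, (ψ ≠ 0 → f ψ ≠ 1) ∧ ψ ∉ Submodule.span F {φ, φ'} := by
    by_contra! hcon
    have hle : (Finset.univ.filter (fun ψ : Dual F V => ψ ≠ 0 → f ψ ≠ 1)).card ≤
        (Finset.univ.filter (fun ψ : Dual F V => ψ ∈ Submodule.span F {φ, φ'})).card := by
      refine Finset.card_le_card fun ψ hψ => ?_
      simp only [Finset.mem_filter, Finset.mem_univ, true_and] at hψ ⊢
      exact hcon ψ hψ
    rw [hcard, card_submodule, finrank_span_pair hφ hφφ'] at hle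
    exact absurd hle (Nat.pow_lt_pow_right Fintype.one_lt_card (by norm_num)).not_ge
  let P : Submodule F (Dual F V) := Submodule.span F {φ, φ', ψ}
  have hsub : Finset.univ.filter (fun χ => χ ∈ P) ⊆
      Finset.univ.filter (fun χ : Dual F V => χ ≠ 0 → f χ ≠ 1) := by
    intro χ hχ
    simp only [Finset.mem_filter, Finset.mem_univ, true_and, P] at hχ ⊢
    obtain ⟨α, ξ, hξ, rfl⟩ := Submodule.mem_span_insert.1 hχ
    obtain ⟨β, γ, rfl⟩ := Submodule.mem_span_pair.1 hξ
    intro hne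
    refine h.ne_one_of_mem_span_pair hφ' h0' (ψ := α • φ + γ • ψ) (fun hne' => ?_)
      (Submodule.mem_span_pair.2 ⟨β, 1, by module⟩) hne
    exact h.ne_one_of_mem_span_pair hφ h0 hψ (Submodule.mem_span_pair.2 ⟨α, γ, rfl⟩) hne'
  have hle := Finset.card_le_card hsub
  rw [hcard, card_submodule, Nat.pow_le_pow_iff_right Fintype.one_lt_card] at hle
  have hlt : Submodule.span F {φ, φ'} < P := by
    refine lt_of_le_of_ne (Submodule.span_mono (by simp [Set.insert_subset_iff])) ?_
    intro hcon
    exact hψM (hcon ▸ Submodule.subset_span (by simp))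
  have hlt' := Submodule.finrank_lt_finrank_of_lt hlt
  rw [finrank_span_pair hφ hφφ'] at hlt'
  have hP : finrank F P = 3 := by omega
  refine ⟨P, hP, fun χ => ?_⟩
  have heq := Finset.eq_of_subset_of_card_le hsub (by rw [hcard, card_submodule, hP])
  have := Finset.ext_iff.1 heq χ
  simpa using this

lemma add_mem_of_mem_dualCoannihilator {φ : Dual F V} (hφ : φ ≠ 0) (h0 : f φ = 0)
    {P : Submodule F (Dual F V)} (hP3 : finrank F P = 3)
    (hP : ∀ ψ, ψ ∈ P ↔ (ψ ≠ 0 → f ψ ≠ 1)) {v w : V} (hv : v ∈ X)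
    (hw : w ∈ P.dualCoannihilator) : v + w ∈ X := by
  have hle {φ : Dual F V} {S : Submodule F V} (hS : IsTrace X f k φ S) :
      P.dualCoannihilator ≤ S := by
    rw [← Subspace.dualAnnihilator_dualCoannihilator_eq (W := S)]
    refine Submodule.dualCoannihilator_anti fun ψ hψ => ?_
    exact (hP ψ).2 (h.ne_one_of_mem_dualAnnihilator hS hψ)
  have hVfin := h.finrank_eq
  by_cases hvP : v ∈ P.dualCoannihilator
  · obtain ⟨S, hS⟩ := h.exists_isTrace hφ h0
    exact ((hS.mem_iff _).1 (hle hS (Submodule.add_mem _ hvP hw))).1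
  · let L : Submodule F V := P.dualCoannihilator ⊔ F ∙ v
    have hL : finrank F L = k + 2 := by
      have h1 := Submodule.finrank_sup_add_finrank_inf_eq P.dualCoannihilator (F ∙ v)
      have h2 : P.dualCoannihilator ⊓ (F ∙ v) = ⊥ := by
        rw [eq_bot_iff]
        rintro x ⟨hx, hxv⟩
        obtain ⟨c, rfl⟩ := Submodule.mem_span_singleton.1 hxv
        by_cases hc : c = 0
        · simp [hc]
        · exact absurd ((Submodule.smul_mem_iff _ hc).1 hx) hvP
      have h3 := Subspace.finrank_add_finrank_dualCoannihilator_eq P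
      have hv0 : v ≠ 0 := by rintro rfl; exact hvP (Submodule.zero_mem _)
      rw [h2, finrank_bot, finrank_span_singleton hv0] at h1
      change finrank F ↥(P.dualCoannihilator ⊔ F ∙ v) = _
      omega
    have hLP : L.dualAnnihilator ≤ P := by
      rw [← Subspace.dualCoannihilator_dualAnnihilator_eq (W := P)]
      exact Submodule.dualAnnihilator_anti le_sup_left
    have hfin : finrank F L.dualAnnihilator = 2 := by
      have := Subspace.finrank_add_finrank_dualAnnihilator_eq L
      omega
    by_cases hex : ∃ ψ ∈ L.dualAnnihilator, ψ ≠ 0 ∧ f ψ = 0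
    · obtain ⟨ψ, hψL, hψ, hψ0⟩ := hex
      obtain ⟨S, hS⟩ := h.exists_isTrace hψ hψ0
      have hvS : v ∈ S := (hS.mem_iff v).2 ⟨hv, (Submodule.mem_dualAnnihilator ψ).1 hψL v
        (le_sup_right (a := P.dualCoannihilator) (Submodule.mem_span_singleton_self v))⟩
      exact ((hS.mem_iff _).1 (S.add_mem hvS (hle hS hw))).1
    · exfalso
      push Not at hex
      have hs := h.two_le_int
      have hq := h.sq_sub_one_pos
      have hu := h.weight_pos
      have h0' : cnt f L.dualAnnihilator 0 = 0 := by
        rw [cnt, Finset.card_eq_zero, Finset.filter_eq_empty_iff]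
        rintro ψ - ⟨h1, h2, h3⟩
        exact hex ψ h1 h2 h3
      have h1' : cnt f L.dualAnnihilator 1 = 0 := by
        rw [cnt, Finset.card_eq_zero, Finset.filter_eq_empty_iff]
        rintro ψ - ⟨h1, h2, h3⟩
        exact (hP ψ).1 (hLP h1) h2 h3
      have h2 := h.cnt_add L.dualAnnihilator
      have h3 := h.pencil L hL
      rw [hfin, h0', h1'] at h2
      rw [h1', h.card_eq hφ h0] at h3
      have h4 : (inCard X L : ℤ) ≤ (s : ℤ) ^ (2 * k + 1) * (s : ℤ) ^ 3 := by
        have h5 : inCard X L ≤ Fintype.card F ^ finrank F L := by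
          rw [← card_submodule]
          exact Finset.card_le_card (Finset.filter_subset_filter _ (Finset.subset_univ X))
        rw [hL] at h5
        have h6 : (inCard X L : ℤ) ≤ ((s : ℤ) ^ 2) ^ (k + 2) := by
          rw [← h.card_field_int]; exact_mod_cast h5
        calc (inCard X L : ℤ) ≤ _ := h6
          _ = _ := by ring
      have h7 : (cnt f L.dualAnnihilator ((s : ℤ) ^ 2) : ℤ) = ((s : ℤ) ^ 2) ^ 2 - 1 := by
        push_cast at h2; linarith
      rw [h7] at h3
      have h8 : (s : ℤ) ^ (2 * k + 1) * ((s : ℤ) ^ 2 - 1) * s ^ 4 ≤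
          (s : ℤ) ^ (2 * k + 1) * ((s : ℤ) ^ 2 - 1) * s ^ 3 := by
        have h9 : (s : ℤ) ^ 2 * inCard X L ≤
            (s : ℤ) ^ 2 * ((s : ℤ) ^ (2 * k + 1) * (s : ℤ) ^ 3) := by gcongr
        have h10 : (s : ℤ) ^ (2 * k + 4) = (s : ℤ) ^ (2 * k + 1) * (s : ℤ) ^ 3 := by ring
        rw [h10] at h3
        push_cast at h3
        linarith
      have h11 := le_of_mul_le_mul_left h8 (mul_pos hu hq)
      have h12 : (0 : ℤ) < s ^ 3 := by positivity
      nlinarith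

end ThreeType
end Main

section Coordinates

variable {F : Type*} [Field F]

/-- A scalar-closed set of triples containing a frame, and containing with any two pairs of its
points the intersection of the lines spanned by them. -/
structure FrameClosed (T : F → F → F → Prop) : Prop where
  smul : ∀ k {a b c}, T a b c → T (k * a) (k * b) (k * c)
  e₀ : T 1 0 0
  e₁ : T 0 1 0
  e₂ : T 0 0 1
  e₃ : T 1 1 1
  inter : ∀ {p₀ p₁ p₂ q₀ q₁ q₂ r₀ r₁ r₂ t₀ t₁ t₂ : F} (l₀ l₁ l₂ α β γ δ : F),
    T p₀ p₁ p₂ → T q₀ q₁ q₂ → T r₀ r₁ r₂ → T t₀ t₁ t₂ →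
    l₀ * r₀ + l₁ * r₁ + l₂ * r₂ = 0 → l₀ * t₀ + l₁ * t₁ + l₂ * t₂ = 0 →
    l₀ * p₀ + l₁ * p₁ + l₂ * p₂ ≠ 0 →
    α * p₀ + β * q₀ = γ * r₀ + δ * t₀ → α * p₁ + β * q₁ = γ * r₁ + δ * t₁ →
    α * p₂ + β * q₂ = γ * r₂ + δ * t₂ →
    T (α * p₀ + β * q₀) (α * p₁ + β * q₁) (α * p₂ + β * q₂)

namespace FrameClosed

variable {T : F → F → F → Prop} (h : FrameClosed T)
include h

lemma swap : FrameClosed (fun a b c => T a c b) where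
  smul k _ _ _ ht := h.smul k ht
  e₀ := h.e₀
  e₁ := h.e₂
  e₂ := h.e₁
  e₃ := h.e₃
  inter := fun l₀ l₁ l₂ α β γ δ hp hq hr ht h1 h2 h3 h4 h5 h6 =>
    h.inter l₀ l₂ l₁ α β γ δ hp hq hr ht (by rw [← h1]; ring) (by rw [← h2]; ring)
      (by rw [add_right_comm]; exact h3) h4 h6 h5

lemma zero_one_one : T 0 1 1 := by
  simpa using h.inter 1 0 0 1 (-1) 1 1 h.e₃ h.e₀ h.e₁ h.e₂ (by ring) (by ring) (by simp)
    (by ring) (by ring) (by ring)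

lemma one_one_zero : T 1 1 0 := by
  simpa using h.inter 0 0 1 1 (-1) 1 1 h.e₃ h.e₂ h.e₀ h.e₁ (by ring) (by ring) (by simp)
    (by ring) (by ring) (by ring)

lemma left_of {x y : F} (hxy : T 1 x y) : T 1 x 0 := by
  by_cases hy : y = 0
  · rwa [hy] at hxy
  · simpa using h.inter 0 0 1 1 (-y) 1 x hxy h.e₂ h.e₀ h.e₁ (by ring) (by ring) (by simpa)
      (by ring) (by ring) (by ring)

lemma right_of_left {x : F} (hx : T 1 x 0) : T 1 0 x := by
  by_cases hx0 : x = 0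
  · rwa [hx0] at hx ⊢
  · have h1 : T 1 x x := by
      simpa using h.inter 0 1 (-1) 1 x 1 x hx h.e₂ h.e₀ h.zero_one_one (by ring) (by ring)
        (by simpa) (by ring) (by ring) (by ring)
    exact h.swap.left_of h1

lemma one_iff {x y : F} : T 1 x y ↔ T 1 x 0 ∧ T 1 y 0 := by
  constructor
  · intro hxy
    exact ⟨h.left_of hxy, h.swap.right_of_left (h.swap.left_of hxy)⟩
  · rintro ⟨hx, hy⟩
    by_cases hy0 : y = 0
    · rwa [hy0]
    · simpa using h.inter y 0 (-1) 1 y 1 x hx h.e₂ (h.right_of_left hy) h.e₁ (by ring) (by ring)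
        (by simpa) (by ring) (by ring) (by ring)

lemma zero_one_iff {m : F} : T 0 1 m ↔ T 1 m 0 := by
  constructor
  · intro hm
    have : T 1 1 m := by
      simpa using h.inter 1 (-1) 0 1 1 1 m h.e₀ hm h.one_one_zero h.e₂ (by ring) (by ring)
        (by simp) (by ring) (by ring) (by ring)
    exact (h.one_iff.1 this).2
  · intro hm
    simpa using h.inter 1 0 0 1 (-1) 1 m (h.one_iff.2 ⟨h.one_one_zero, hm⟩) h.e₀ h.e₁ h.e₂
      (by ring) (by ring) (by simp) (by ring) (by ring) (by ring)

lemma mul_mem {x m : F} (hx : T 1 x 0) (hm : T 1 m 0) : T 1 (x * m) 0 := by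
  by_cases hx0 : x = 0
  · simpa [hx0] using h.e₀
  · have : T 1 x (x * m) := by
      simpa using h.inter x (-1) 0 1 x 1 (x * m) h.e₀ (h.zero_one_iff.2 hm) hx h.e₂ (by ring)
        (by ring) (by simpa) (by ring) (by ring) (by ring)
    exact (h.one_iff.1 this).2

/-- If the affine part of a coordinate line is a subfield, the set is a Baer subplane. -/
lemma iff_exists {F₀ : Subfield F} (hF₀ : ∀ x, T 1 x 0 ↔ x ∈ F₀) {a b c : F} :
    T a b c ↔ ∃ k x y z : F, x ∈ F₀ ∧ y ∈ F₀ ∧ z ∈ F₀ ∧ a = k * x ∧ b = k * y ∧ c = k * z := by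
  constructor
  · intro ht
    by_cases ha : a = 0
    · subst ha
      by_cases hb : b = 0
      · subst hb
        exact ⟨c, 0, 0, 1, F₀.zero_mem, F₀.zero_mem, F₀.one_mem, by simp, by simp, by simp⟩
      · have h1 := h.smul b⁻¹ ht
        rw [mul_zero, inv_mul_cancel₀ hb, h.zero_one_iff, hF₀] at h1
        exact ⟨b, 0, 1, b⁻¹ * c, F₀.zero_mem, F₀.one_mem, h1, by simp, by simp, by field_simp⟩
    · have h1 := h.smul a⁻¹ ht
      rw [inv_mul_cancel₀ ha, h.one_iff, hF₀, hF₀] at h1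
      exact ⟨a, 1, a⁻¹ * b, a⁻¹ * c, F₀.one_mem, h1.1, h1.2, by simp, by field_simp, by field_simp⟩
  · rintro ⟨k, x, y, z, hx, hy, hz, rfl, rfl, rfl⟩
    apply h.smul
    by_cases hx0 : x = 0
    · subst hx0
      by_cases hy0 : y = 0
      · subst hy0
        simpa using h.smul z h.e₂
      · have h1 : T 0 1 (y⁻¹ * z) :=
          h.zero_one_iff.2 ((hF₀ _).2 (F₀.mul_mem (F₀.inv_mem hy) hz))
        simpa [hy0] using h.smul y h1
    · have h1 : T 1 (x⁻¹ * y) (x⁻¹ * z) :=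
        h.one_iff.2 ⟨(hF₀ _).2 (F₀.mul_mem (F₀.inv_mem hx) hy),
          (hF₀ _).2 (F₀.mul_mem (F₀.inv_mem hx) hz)⟩
      simpa [hx0] using h.smul x h1

end FrameClosed

lemma pow_card_eq_self_of_mul_mem {E : Finset F} (h0 : 0 ∈ E)
    (hmul : ∀ x ∈ E, ∀ y ∈ E, x * y ∈ E) {x : F} (hx : x ∈ E) : x ^ E.card = x := by
  by_cases hx0 : x = 0
  · subst hx0
    exact zero_pow (Finset.card_pos.2 ⟨0, h0⟩).ne'
  · have himg : (E.erase 0).image (x * ·) = E.erase 0 := by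
      apply Finset.eq_of_subset_of_card_le
      · intro y hy
        simp only [Finset.mem_image, Finset.mem_erase] at hy ⊢
        obtain ⟨z, ⟨hz0, hz⟩, rfl⟩ := hy
        exact ⟨mul_ne_zero hx0 hz0, hmul x hx z hz⟩
      · rw [Finset.card_image_of_injective _ (mul_right_injective₀ hx0)]
    have h1 : ∏ y ∈ E.erase 0, y = x ^ (E.erase 0).card * ∏ y ∈ E.erase 0, y := by
      conv_lhs => rw [← himg]
      rw [Finset.prod_image (fun _ _ _ _ hab => mul_right_injective₀ hx0 hab),
        Finset.prod_mul_distrib, Finset.prod_const]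
    have h2 : ∏ y ∈ E.erase 0, y ≠ 0 :=
      Finset.prod_ne_zero_iff.2 fun y hy => (Finset.mem_erase.1 hy).1
    have h3 : x ^ (E.erase 0).card = 1 := by
      apply mul_right_cancel₀ h2
      rw [← h1, one_mul]
    rw [← Finset.card_erase_add_one h0, pow_succ, h3, one_mul]

lemma mem_iff_mem_subfield [Fintype F] {E : Finset F} (h0 : 0 ∈ E)
    (hmul : ∀ x ∈ E, ∀ y ∈ E, x * y ∈ E) {s : ℕ} (hs : 2 ≤ s) (hE : E.card = s)
    {F₀ : Subfield F} (hF₀ : Nat.card F₀ = s) (x : F) : x ∈ E ↔ x ∈ F₀ := by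
  let R : Finset F := Finset.univ.filter (fun x => x ^ s = x)
  have hR : R.card ≤ s := by
    have hdeg := FiniteField.X_pow_card_sub_X_natDegree_eq F (show 1 < s by omega)
    have hne := FiniteField.X_pow_card_sub_X_ne_zero F (show 1 < s by omega)
    rw [← hdeg]
    refine le_trans ?_ (Polynomial.card_roots' _)
    refine le_trans (Finset.card_le_card ?_) (Multiset.toFinset_card_le _)
    intro y hy
    simp only [R, Finset.mem_filter, Finset.mem_univ, true_and] at hy
    rw [Multiset.mem_toFinset, Polynomial.mem_roots hne]
    simp [hy]
  have hER : E = R := by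
    apply Finset.eq_of_subset_of_card_le _ (hE ▸ hR)
    intro y hy
    simp only [R, Finset.mem_filter, Finset.mem_univ, true_and]
    rw [← hE]
    exact pow_card_eq_self_of_mul_mem h0 hmul hy
  have : Fintype F₀ := Fintype.ofFinite _
  have hFR : Finset.univ.filter (fun y => y ∈ F₀) = R := by
    apply Finset.eq_of_subset_of_card_le
    · intro y hy
      simp only [R, Finset.mem_filter, Finset.mem_univ, true_and] at hy ⊢
      have := FiniteField.pow_card (⟨y, hy⟩ : F₀)
      rw [← Nat.card_eq_fintype_card, hF₀] at this
      exact congrArg Subtype.val this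
    · refine hR.trans ?_
      rw [← hF₀, Nat.card_eq_fintype_card, Fintype.card_subtype]
  rw [hER, ← hFR]
  simp

end Coordinates

section BaerPlane

variable {F : Type*} [Field F] [Fintype F] {W : Type*} [AddCommGroup W] [Module F W] [Fintype W]
  [Fintype (Dual F W)]

/-- A scalar-closed set of vectors of a `3`-dimensional space over `GF(s ^ 2)` with the size and
the line intersection numbers of (the cone of) a Baer subplane. -/
structure BaerCounts (F : Type*) [Field F] [Fintype F] {W : Type*} [AddCommGroup W] [Module F W]
    (B : Finset W) (s : ℕ) : Prop where
  card_field : Fintype.card F = s ^ 2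
  two_le : 2 ≤ s
  finrank_eq : finrank F W = 3
  zero_mem : (0 : W) ∈ B
  smul_mem : ∀ (c : F), ∀ v ∈ B, c • v ∈ B
  card_eq : (B.card : ℤ) = (s : ℤ) ^ 4 + ((s : ℤ) ^ 2 - 1) * s
  zeros_eq : ∀ φ : Dual F W, φ ≠ 0 →
    (zeros B φ : ℤ) = (s : ℤ) ^ 2 ∨ (zeros B φ : ℤ) = (s : ℤ) ^ 2 + ((s : ℤ) ^ 2 - 1) * s

namespace BaerCounts

variable {B : Finset W} {s : ℕ} (h : BaerCounts F B s)
include h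

lemma two_le_int : (2 : ℤ) ≤ s := by exact_mod_cast h.two_le

lemma card_field_int : (Fintype.card F : ℤ) = (s : ℤ) ^ 2 := by
  rw [h.card_field]; push_cast; rfl

lemma sq_sub_one_pos : (0 : ℤ) < (s : ℤ) ^ 2 - 1 := by nlinarith [h.two_le_int]

lemma card_span {p : W} (hp : p ≠ 0) :
    ((Finset.univ.filter (fun v => v ∈ F ∙ p)).card : ℤ) = (s : ℤ) ^ 2 := by
  rw [card_submodule, finrank_span_singleton hp, pow_one, h.card_field_int]

/-- A line with two points of `B` is long. -/
lemma zeros_eq_of_mem {φ : Dual F W} (hφ : φ ≠ 0) {p q : W} (hp : p ∈ B) (hp0 : p ≠ 0)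
    (hq : q ∈ B) (hqp : q ∉ F ∙ p) (hφp : φ p = 0) (hφq : φ q = 0) :
    (zeros B φ : ℤ) = (s : ℤ) ^ 2 + ((s : ℤ) ^ 2 - 1) * s := by
  refine (h.zeros_eq φ hφ).resolve_left fun hcon => ?_
  rw [← h.card_span hp0] at hcon
  have hsub : Finset.univ.filter (fun v => v ∈ F ∙ p) ⊆ B.filter (fun v => φ v = 0) := by
    intro v hv
    simp only [Finset.mem_filter, Finset.mem_univ, true_and] at hv ⊢
    obtain ⟨c, rfl⟩ := Submodule.mem_span_singleton.1 hv
    exact ⟨h.smul_mem c p hp, by simp [hφp]⟩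
  have heq := Finset.eq_of_subset_of_card_le hsub (by exact_mod_cast hcon.le)
  apply hqp
  have : q ∈ B.filter (fun v => φ v = 0) := by simp [hq, hφq]
  rw [← heq] at this
  simpa using this

lemma exists_dual {p q : W} (hp0 : p ≠ 0) (hqp : q ∉ F ∙ p) :
    ∃ φ : Dual F W, φ ≠ 0 ∧ φ p = 0 ∧ φ q = 0 ∧ LinearMap.ker φ = Submodule.span F {p, q} := by
  have h2 := finrank_span_pair hp0 hqp
  have hlt : Submodule.span F {p, q} < ⊤ := by
    refine lt_of_le_of_ne le_top fun hcon => ?_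
    rw [hcon, finrank_top, h.finrank_eq] at h2
    omega
  obtain ⟨φ, hφ, hle⟩ := Submodule.exists_le_ker_of_lt_top _ hlt
  refine ⟨φ, hφ, hle (Submodule.subset_span (by simp)), hle (Submodule.subset_span (by simp)), ?_⟩
  symm
  apply Submodule.eq_of_le_of_finrank_eq hle
  have := Module.Dual.finrank_ker_add_one_of_ne_zero hφ
  rw [h.finrank_eq] at this
  omega

/-- A point outside `B` is on a single long line. -/
lemma card_long {w : W} (hw : w ∉ B) :
    ((Finset.univ.filter (fun φ : Dual F W => φ ∈ (F ∙ w).dualAnnihilator ∧ φ ≠ 0 ∧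
      (zeros B φ : ℤ) ≠ (s : ℤ) ^ 2)).card : ℤ) = (s : ℤ) ^ 2 - 1 := by
  have hw0 : w ≠ 0 := by rintro rfl; exact hw h.zero_mem
  have hs := h.two_le_int
  have hq1 := h.sq_sub_one_pos
  have hlong : 0 < ((s : ℤ) ^ 2 - 1) * s := by positivity
  have hspan := finrank_span_singleton (K := F) hw0
  have hM : finrank F (F ∙ w).dualAnnihilator = 2 := by
    have := Subspace.finrank_add_finrank_dualAnnihilator_eq (F ∙ w)
    rw [h.finrank_eq, hspan] at this
    omega
  have h1 := sum_zeros B (F ∙ w) 1 (by rw [h.finrank_eq, hspan])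
  have hin : inCard B (F ∙ w) = 1 := by
    rw [inCard, Finset.card_eq_one]
    refine ⟨0, Finset.ext fun v => ?_⟩
    simp only [Finset.mem_filter, Finset.mem_singleton]
    constructor
    · rintro ⟨hv, hvw⟩
      obtain ⟨c, rfl⟩ := Submodule.mem_span_singleton.1 hvw
      by_contra hc
      have hc0 : c ≠ 0 := by rintro rfl; simp at hc
      apply hw
      simpa [smul_smul, hc0] using h.smul_mem c⁻¹ _ hv
    · rintro rfl
      exact ⟨h.zero_mem, Submodule.zero_mem _⟩
  set M := (F ∙ w).dualAnnihilator
  have h2 : ∀ φ ∈ (Finset.univ.filter (fun φ : Dual F W => φ ∈ M)).erase 0,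
      (zeros B φ : ℤ) = (s : ℤ) ^ 2 +
        if (zeros B φ : ℤ) ≠ (s : ℤ) ^ 2 then ((s : ℤ) ^ 2 - 1) * s else 0 := by
    intro φ hφ
    rcases h.zeros_eq φ (Finset.mem_erase.1 hφ).1 with h3 | h3
    · simp [h3]
    · rw [if_pos (by rw [h3]; omega), h3]
  have hz : zeros B (0 : Dual F W) = B.card := by simp [zeros]
  have hA : ((Finset.univ.filter (fun φ : Dual F W => φ ∈ M)).erase 0).filter
      (fun φ => (zeros B φ : ℤ) ≠ (s : ℤ) ^ 2) = Finset.univ.filter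
      (fun φ : Dual F W => φ ∈ M ∧ φ ≠ 0 ∧ (zeros B φ : ℤ) ≠ (s : ℤ) ^ 2) := by
    ext φ
    simp only [Finset.mem_filter, Finset.mem_erase, Finset.mem_univ, true_and]
    tauto
  rw [← Finset.add_sum_erase _ _ (a := 0) (by simp), hz, Finset.sum_congr rfl h2,
    Finset.sum_add_distrib, ← Finset.sum_filter, hA, Finset.sum_const, Finset.sum_const,
    Finset.card_erase_of_mem (by simp), card_submodule, hM, nsmul_eq_mul, nsmul_eq_mul,
    Nat.cast_pred (pow_pos Fintype.card_pos 2), Nat.cast_pow, h.card_field_int,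
    h.card_eq, hin] at h1
  apply mul_left_cancel₀ hlong.ne'
  push_cast at h1
  linear_combination h1

lemma mem_of_mem_span_pair {p q r t w : W} (hp : p ∈ B) (hq : q ∈ B) (hr : r ∈ B) (ht : t ∈ B)
    (hprt : p ∉ Submodule.span F {r, t}) (hpq : w ∈ Submodule.span F {p, q})
    (hrt : w ∈ Submodule.span F {r, t}) : w ∈ B := by
  by_contra hw
  have hspan {a b : W} (ha : a ∈ B) (hb : b ∈ F ∙ a) (hab : w ∈ Submodule.span F {a, b}) :
      False := by
    obtain ⟨c, rfl⟩ := Submodule.mem_span_singleton.1 hb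
    obtain ⟨α, β, rfl⟩ := Submodule.mem_span_pair.1 hab
    rw [smul_smul, ← add_smul] at hw
    exact hw (h.smul_mem _ _ ha)
  have hp0 : p ≠ 0 := by rintro rfl; exact hprt (Submodule.zero_mem _)
  have hr0 : r ≠ 0 := by
    rintro rfl
    rw [Submodule.span_insert_zero] at hrt
    obtain ⟨c, rfl⟩ := Submodule.mem_span_singleton.1 hrt
    exact hw (h.smul_mem _ _ ht)
  have hqp : q ∉ F ∙ p := fun hc => hspan hp hc hpq
  have htr : t ∉ F ∙ r := fun hc => hspan hr hc hrt
  obtain ⟨φ, hφ, hφp, hφq, hφk⟩ := h.exists_dual hp0 hqp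
  obtain ⟨ψ, hψ, hψr, hψt, hψk⟩ := h.exists_dual hr0 htr
  have hφz := h.zeros_eq_of_mem hφ hp hp0 hq hqp hφp hφq
  have hψz := h.zeros_eq_of_mem hψ hr hr0 ht htr hψr hψt
  have hs := h.two_le_int
  have hq1 := h.sq_sub_one_pos
  have hne : (s : ℤ) ^ 2 + ((s : ℤ) ^ 2 - 1) * s ≠ (s : ℤ) ^ 2 := by
    have : 0 < ((s : ℤ) ^ 2 - 1) * s := by positivity
    omega
  have hann {χ : Dual F W} (hχ : w ∈ LinearMap.ker χ) : χ ∈ (F ∙ w).dualAnnihilator := by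
    rw [Submodule.mem_dualAnnihilator]
    intro v hv
    obtain ⟨c, rfl⟩ := Submodule.mem_span_singleton.1 hv
    rw [map_smul, LinearMap.mem_ker.1 hχ, smul_zero]
  have hlong := h.card_long hw
  set A := Finset.univ.filter (fun φ : Dual F W => φ ∈ (F ∙ w).dualAnnihilator ∧ φ ≠ 0 ∧
      (zeros B φ : ℤ) ≠ (s : ℤ) ^ 2) with hAdef
  have hsub : insert ψ ((Finset.univ.filter (fun χ => χ ∈ F ∙ φ)).erase 0) ⊆ A := by
    intro χ hχ
    rw [Finset.mem_insert] at hχ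
    simp only [Finset.mem_erase, Finset.mem_filter, Finset.mem_univ, true_and, A] at hχ ⊢
    rcases hχ with rfl | ⟨hχ0, hχ⟩
    · exact ⟨hann (hψk ▸ hrt), hψ, hψz ▸ hne⟩
    · obtain ⟨c, rfl⟩ := Submodule.mem_span_singleton.1 hχ
      have hc : c ≠ 0 := by rintro rfl; simp at hχ0
      refine ⟨Submodule.smul_mem _ _ (hann (hφk ▸ hpq)), hχ0, ?_⟩
      have : zeros B (c • φ) = zeros B φ := by simp [zeros, hc]
      rw [this]
      exact hφz ▸ hne
  have hle := Finset.card_le_card hsub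
  rw [Finset.card_insert_of_notMem, Finset.card_erase_of_mem (by simp), card_submodule,
    finrank_span_singleton hφ, pow_one, Nat.sub_add_cancel Fintype.card_pos] at hle
  · have : (Fintype.card F : ℤ) ≤ A.card := by exact_mod_cast hle
    rw [h.card_field_int, hlong] at this
    omega
  · simp only [Finset.mem_erase, Finset.mem_filter, Finset.mem_univ, true_and, not_and]
    rintro - hcon
    obtain ⟨c, rfl⟩ := Submodule.mem_span_singleton.1 hcon
    apply hprt
    rw [← hψk, LinearMap.mem_ker, LinearMap.smul_apply, hφp, smul_zero]

end BaerCounts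
end BaerPlane

section BaerPlane

variable {F : Type*} [Field F] [Fintype F] {W : Type*} [AddCommGroup W] [Module F W] [Fintype W]
  [Fintype (Dual F W)]

lemma basis_notMem_span {ι : Type*} (b : Basis ι F W) {i j : ι} (hij : i ≠ j) :
    b j ∉ F ∙ b i := by
  intro hc
  obtain ⟨c, hc⟩ := Submodule.mem_span_singleton.1 hc
  have := congrArg (fun v => b.repr v j) hc
  simp [hij] at this

namespace BaerCounts

variable {B : Finset W} {s : ℕ} (h : BaerCounts F B s)
include h

lemma exists_basis : ∃ b : Basis (Fin 3) F W, ∀ i, b i ∈ B := by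
  have hs := h.two_le_int
  have hq1 := h.sq_sub_one_pos
  have hlong : 0 < ((s : ℤ) ^ 2 - 1) * s := by positivity
  obtain ⟨p, hp, hp0⟩ : ∃ p ∈ B, p ≠ 0 := by
    by_contra! hcon
    have hle : B.card ≤ 1 := Finset.card_le_one.2 fun a ha b hb => by rw [hcon a ha, hcon b hb]
    have : (B.card : ℤ) ≤ 1 := by exact_mod_cast hle
    rw [h.card_eq] at this
    nlinarith [sq_nonneg ((s : ℤ) ^ 2)]
  obtain ⟨r, hr, hrp⟩ : ∃ r ∈ B, r ∉ F ∙ p := by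
    by_contra! hcon
    have hle : B.card ≤ (Finset.univ.filter (fun v => v ∈ F ∙ p)).card :=
      Finset.card_le_card fun v hv => by simpa using hcon v hv
    have : (B.card : ℤ) ≤ (Finset.univ.filter (fun v => v ∈ F ∙ p)).card := by exact_mod_cast hle
    rw [h.card_eq, h.card_span hp0] at this
    nlinarith [sq_nonneg ((s : ℤ) ^ 2)]
  obtain ⟨φ, hφ, hφp, hφr, hφk⟩ := h.exists_dual hp0 hrp
  obtain ⟨t, ht, hφt⟩ : ∃ t ∈ B, φ t ≠ 0 := by
    by_contra! hcon
    have hz := h.zeros_eq_of_mem hφ hp hp0 hr hrp hφp hφr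
    have : zeros B φ = B.card := by rw [zeros, Finset.filter_true_of_mem hcon]
    rw [this, h.card_eq] at hz
    nlinarith
  have hli : LinearIndependent F ![p, r, t] := by
    rw [Fintype.linearIndependent_iff]
    intro g hg
    simp only [Fin.sum_univ_three, Matrix.cons_val_zero, Matrix.cons_val_one, Matrix.cons_val] at hg
    have h2 : g 2 = 0 := by
      have := congrArg φ hg
      simpa [hφp, hφr, hφt] using this
    have h1 : g 1 = 0 := by
      by_contra h1
      apply hrp
      rw [Submodule.mem_span_singleton]
      refine ⟨-((g 1)⁻¹ * g 0), ?_⟩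
      rw [h2, zero_smul, add_zero] at hg
      have := congrArg ((g 1)⁻¹ • ·) hg
      simp only [smul_add, smul_smul, inv_mul_cancel₀ h1, one_smul, smul_zero] at this
      rw [neg_smul, neg_eq_of_add_eq_zero_right this]
    have h0 : g 0 = 0 := by simpa [h1, h2, hp0] using hg
    intro i
    fin_cases i
    exacts [h0, h1, h2]
  refine ⟨basisOfLinearIndependentOfCardEqFinrank hli (by simp [h.finrank_eq]), fun i => ?_⟩
  rw [coe_basisOfLinearIndependentOfCardEqFinrank]
  fin_cases i
  exacts [hp, hr, ht]

lemma zeros_coord (b : Basis (Fin 3) F W) (hb : ∀ i, b i ∈ B) (i : Fin 3) :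
    (zeros B (b.coord i) : ℤ) = (s : ℤ) ^ 2 + ((s : ℤ) ^ 2 - 1) * s := by
  obtain ⟨j, l, hj, hl, hjl⟩ : ∃ j l : Fin 3, j ≠ i ∧ l ≠ i ∧ j ≠ l := by
    revert i; decide
  refine h.zeros_eq_of_mem (p := b j) (q := b l) (fun hc => ?_) (hb j) (b.ne_zero j) (hb l)
    (basis_notMem_span b hjl) ?_ ?_
  · have := congrArg (fun φ : Dual F W => φ (b i)) hc
    simp at this
  · simp [hj]
  · simp [hl]

lemma exists_frame : ∃ b : Basis (Fin 3) F W, (∀ i, b i ∈ B) ∧ b 0 + b 1 + b 2 ∈ B := by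
  obtain ⟨b, hb⟩ := h.exists_basis
  have hs := h.two_le_int
  have hq1 := h.sq_sub_one_pos
  obtain ⟨v, hv, hv0⟩ : ∃ v ∈ B, ∀ i, b.coord i v ≠ 0 := by
    by_contra! hcon
    have hspan (i : Fin 3) : Finset.univ.filter (fun v => v ∈ F ∙ b i) ⊆ B ∧ ∀ j ≠ i,
        Finset.univ.filter (fun v => v ∈ F ∙ b i) ⊆ B.filter (fun v => b.coord j v = 0) := by
      have hB : Finset.univ.filter (fun v => v ∈ F ∙ b i) ⊆ B := by
        intro v hv
        simp only [Finset.mem_filter, Finset.mem_univ, true_and] at hv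
        obtain ⟨c, rfl⟩ := Submodule.mem_span_singleton.1 hv
        exact h.smul_mem c _ (hb i)
      refine ⟨hB, fun j hj v hv => Finset.mem_filter.2 ⟨hB hv, ?_⟩⟩
      simp only [Finset.mem_filter, Finset.mem_univ, true_and] at hv
      obtain ⟨c, rfl⟩ := Submodule.mem_span_singleton.1 hv
      simp [hj.symm]
    have hcard (i : Fin 3) : ((B.filter (fun v => b.coord i v = 0)).card : ℤ) =
        (s : ℤ) ^ 2 + ((s : ℤ) ^ 2 - 1) * s := h.zeros_coord b hb i
    set A : Fin 3 → Finset W := fun i => B.filter (fun v => b.coord i v = 0) with hA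
    have hBA : B ⊆ A 0 ∪ A 1 ∪ A 2 := by
      intro v hv
      obtain ⟨i, hi⟩ := hcon v hv
      have : v ∈ A i := Finset.mem_filter.2 ⟨hv, hi⟩
      fin_cases i <;> simp_all
    have h01 : (Finset.univ.filter (fun v => v ∈ F ∙ b 2)).card ≤ (A 0 ∩ A 1).card :=
      Finset.card_le_card (Finset.subset_inter ((hspan 2).2 0 (by decide))
        ((hspan 2).2 1 (by decide)))
    have h012 : (Finset.univ.filter (fun v => v ∈ F ∙ b 0)).card + 1 ≤
        ((A 0 ∪ A 1) ∩ A 2).card := by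
      rw [← Finset.card_insert_of_notMem (a := b 1)
        (by simpa using basis_notMem_span b (show (0 : Fin 3) ≠ 1 by decide))]
      refine Finset.card_le_card (Finset.insert_subset ?_ (Finset.subset_inter
        (((hspan 0).2 1 (by decide)).trans Finset.subset_union_right)
        ((hspan 0).2 2 (by decide))))
      simp [A, hb]
    have h1 := Finset.card_union_add_card_inter (A 0) (A 1)
    have h2 := Finset.card_union_add_card_inter (A 0 ∪ A 1) (A 2)
    have h3 := Finset.card_le_card hBA
    zify at h01 h012 h1 h2 h3
    rw [h.card_span (b.ne_zero _)] at h01 h012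
    rw [h.card_eq] at h3
    rw [hcard] at h1 h2
    rw [hcard] at h1
    have h4 : (s : ℤ) ^ 2 * ((s : ℤ) ^ 2 - 1) + 1 ≤ 2 * s * ((s : ℤ) ^ 2 - 1) := by linarith
    have h5 : 2 * s * ((s : ℤ) ^ 2 - 1) ≤ (s : ℤ) ^ 2 * ((s : ℤ) ^ 2 - 1) := by
      apply mul_le_mul_of_nonneg_right _ hq1.le
      nlinarith
    linarith
  refine ⟨b.isUnitSMul (w := fun i => b.coord i v) (fun i => isUnit_iff_ne_zero.2 (hv0 i)),
    fun i => ?_, ?_⟩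
  · rw [Basis.isUnitSMul_apply]
    exact h.smul_mem _ _ (hb i)
  · have := b.sum_repr v
    rw [Fin.sum_univ_three] at this
    simp only [Basis.isUnitSMul_apply, Basis.coord_apply]
    rwa [this]

lemma frameClosed (b : Basis (Fin 3) F W) (hb : ∀ i, b i ∈ B) (hb3 : b 0 + b 1 + b 2 ∈ B) :
    FrameClosed (fun x y z : F => x • b 0 + y • b 1 + z • b 2 ∈ B) where
  smul k x y z ht := by
    simpa [smul_smul] using h.smul_mem k _ ht
  e₀ := by simpa using hb 0
  e₁ := by simpa using hb 1
  e₂ := by simpa using hb 2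
  e₃ := by simpa using hb3
  inter := by
    intro p₀ p₁ p₂ q₀ q₁ q₂ r₀ r₁ r₂ t₀ t₁ t₂ l₀ l₁ l₂ α β γ δ hp hq hr ht h1 h2 h3 h4 h5 h6
    have hval (x y z : F) : b.constr F ![l₀, l₁, l₂] (x • b 0 + y • b 1 + z • b 2) =
        l₀ * x + l₁ * y + l₂ * z := by
      simp only [map_add, map_smul, Basis.constr_basis, smul_eq_mul, Matrix.cons_val_zero,
        Matrix.cons_val_one, Matrix.cons_val]
      ring
    refine h.mem_of_mem_span_pair hp hq hr ht ?_ (Submodule.mem_span_pair.2 ⟨α, β, by module⟩)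
      (Submodule.mem_span_pair.2 ⟨γ, δ, by rw [h4, h5, h6]; module⟩)
    intro hc
    obtain ⟨c, d, hcd⟩ := Submodule.mem_span_pair.1 hc
    have := congrArg (b.constr F ![l₀, l₁, l₂]) hcd
    rw [map_add, map_smul, map_smul, hval, hval, hval, h1, h2, smul_zero, smul_zero,
      add_zero] at this
    exact h3 this.symm

lemma card_affine (b : Basis (Fin 3) F W) (hb : ∀ i, b i ∈ B) :
    (Finset.univ.filter (fun x : F => (1 : F) • b 0 + x • b 1 + (0 : F) • b 2 ∈ B)).card = s := by
  have hq1 := h.sq_sub_one_pos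
  have hz := h.zeros_coord b hb 2
  have hrepr {v : W} (hv : b.coord 2 v = 0) : b.coord 0 v • b 0 + b.coord 1 v • b 1 = v := by
    have := b.sum_repr v
    rw [Fin.sum_univ_three] at this
    rw [Basis.coord_apply] at hv
    rwa [hv, zero_smul, add_zero] at this
  set E := Finset.univ.filter (fun x : F => (1 : F) • b 0 + x • b 1 + (0 : F) • b 2 ∈ B) with hE
  set A := B.filter (fun v => b.coord 2 v = 0) with hA
  have h1 : A.filter (fun v => b.coord 0 v = 0) = Finset.univ.filter (fun v => v ∈ F ∙ b 1) := by
    ext v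
    simp only [A, Finset.mem_filter, Finset.mem_univ, true_and, Submodule.mem_span_singleton]
    constructor
    · rintro ⟨⟨hv, hv2⟩, hv0⟩
      refine ⟨b.coord 1 v, ?_⟩
      conv_rhs => rw [← hrepr hv2]
      rw [hv0, zero_smul, zero_add]
    · rintro ⟨c, rfl⟩
      exact ⟨⟨h.smul_mem c _ (hb 1), by simp⟩, by simp⟩
  have h2 : ((Finset.univ.erase (0 : F)) ×ˢ E).card =
      (A.filter (fun v => ¬ b.coord 0 v = 0)).card := by
    refine Finset.card_bij (fun y _ => y.1 • ((1 : F) • b 0 + y.2 • b 1 + (0 : F) • b 2)) ?_ ?_ ?_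
    · rintro ⟨a, x⟩ hy
      simp only [E, Finset.mem_product, Finset.mem_erase, Finset.mem_univ, and_true,
        Finset.mem_filter, true_and] at hy
      simp only [A, Finset.mem_filter]
      exact ⟨⟨h.smul_mem a _ hy.2, by simp⟩, by simpa using hy.1⟩
    · rintro ⟨a, x⟩ hy ⟨a', x'⟩ hy' heq
      simp only [Finset.mem_product, Finset.mem_erase, Finset.mem_univ, and_true] at hy
      have ha := congrArg (b.coord 0) heq
      have hx := congrArg (b.coord 1) heq
      simp at ha hx
      subst ha
      simp only [mul_eq_mul_left_iff, hy.1, or_false] at hx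
      rw [hx]
    · intro v hv
      simp only [A, Finset.mem_filter] at hv
      obtain ⟨⟨hvB, hv2⟩, hv0⟩ := hv
      have heq : b.coord 0 v • ((1 : F) • b 0 + ((b.coord 0 v)⁻¹ * b.coord 1 v) • b 1 +
          (0 : F) • b 2) = v := by
        conv_rhs => rw [← hrepr hv2]
        simp only [smul_add, smul_smul, mul_one, zero_smul, add_zero,
          mul_inv_cancel_left₀ hv0]
      refine ⟨(b.coord 0 v, (b.coord 0 v)⁻¹ * b.coord 1 v), ?_, heq⟩
      simp only [E, Finset.mem_product, Finset.mem_erase, Finset.mem_univ, and_true,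
        Finset.mem_filter, true_and]
      refine ⟨hv0, ?_⟩
      have := h.smul_mem (b.coord 0 v)⁻¹ v hvB
      rwa [← heq, smul_smul, heq, inv_mul_cancel₀ hv0, one_smul] at this
  have h3 := Finset.card_filter_add_card_filter_not (s := A) (fun v => b.coord 0 v = 0)
  rw [← h2, h1, Finset.card_product, Finset.card_erase_of_mem (Finset.mem_univ _),
    Finset.card_univ] at h3
  have h4 : (A.card : ℤ) = (s : ℤ) ^ 2 + ((s : ℤ) ^ 2 - 1) * s := hz
  rw [← h3, Nat.cast_add, Nat.cast_mul, Nat.cast_pred Fintype.card_pos, h.card_field_int,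
    h.card_span (b.ne_zero 1)] at h4
  exact_mod_cast mul_left_cancel₀ hq1.ne' (add_left_cancel h4)

/-- A set with the size and the line intersection numbers of a Baer subplane is one. -/
lemma exists_basis_iff {F₀ : Subfield F} (hF₀ : Nat.card F₀ = s) :
    ∃ b : Basis (Fin 3) F W, ∀ v, v ∈ B ↔
      ∃ (k : F) (c : Fin 3 → F), (∀ i, c i ∈ F₀) ∧ v = k • ∑ i, c i • b i := by
  obtain ⟨b, hb, hb3⟩ := h.exists_frame
  have hT := h.frameClosed b hb hb3
  have hE : ∀ x : F, (1 : F) • b 0 + x • b 1 + (0 : F) • b 2 ∈ B ↔ x ∈ F₀ := by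
    intro x
    have := mem_iff_mem_subfield
      (E := Finset.univ.filter (fun x : F => (1 : F) • b 0 + x • b 1 + (0 : F) • b 2 ∈ B))
      (by simpa using hb 0) (fun x hx y hy => by
        simp only [Finset.mem_filter, Finset.mem_univ, true_and] at hx hy ⊢
        exact hT.mul_mem hx hy) h.two_le (h.card_affine b hb) hF₀ x
    simpa only [Finset.mem_filter, Finset.mem_univ, true_and] using this
  refine ⟨b, fun v => ?_⟩
  have hsum := b.sum_repr v
  rw [Fin.sum_univ_three] at hsum
  constructor
  · intro hv
    rw [← hsum] at hv
    obtain ⟨k, x, y, z, hx, hy, hz, h0, h1, h2⟩ := (hT.iff_exists hE).1 hv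
    refine ⟨k, ![x, y, z], fun i => by fin_cases i <;> assumption, ?_⟩
    rw [← hsum, h0, h1, h2, Fin.sum_univ_three]
    simp only [Matrix.cons_val_zero, Matrix.cons_val_one, Matrix.cons_val]
    module
  · rintro ⟨k, c, hc, rfl⟩
    have := (hT.iff_exists hE).2
      ⟨k, c 0, c 1, c 2, hc 0, hc 1, hc 2, rfl, rfl, rfl⟩
    rw [Fin.sum_univ_three]
    convert this using 1
    module

end BaerCounts
end BaerPlane

section Main

variable {F : Type*} [Field F] [Fintype F] {V : Type*} [AddCommGroup V] [Module F V] [Fintype V]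
  [Fintype (Dual F V)]

namespace ThreeType

variable {X : Finset V} {f : Dual F V → ℤ} {s k : ℕ} (h : ThreeType F X f s k)
include h

lemma baerCounts {φ : Dual F V} (hφ : φ ≠ 0) (h0 : f φ = 0) {P : Submodule F (Dual F V)}
    (hP3 : finrank F P = 3) (hP : ∀ ψ, ψ ∈ P ↔ (ψ ≠ 0 → f ψ ≠ 1)) {W : Type*} [AddCommGroup W]
    [Module F W] [Fintype W] {π : V →ₗ[F] W} (hπ : Function.Surjective π)
    (hker : LinearMap.ker π = P.dualCoannihilator) {B : Finset W} (hB : ∀ v, π v ∈ B ↔ v ∈ X) :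
    BaerCounts F B s := by
  have hq := h.sq_sub_one_pos
  have hu := h.weight_pos
  have hs : (0 : ℤ) < s := by have := h.two_le_int; omega
  have hkfin : finrank F (LinearMap.ker π) = k + 1 := by
    have h1 := Subspace.finrank_add_finrank_dualCoannihilator_eq P
    have h2 := h.finrank_eq
    rw [hker]
    omega
  have hpow : (Fintype.card F : ℤ) ^ (k + 1) = (s : ℤ) ^ (2 * k + 1) * s := by
    rw [h.card_field_int]; ring
  refine ⟨h.card_field, h.two_le, ?_, ?_, ?_, ?_, ?_⟩
  · have h1 := LinearMap.finrank_range_add_finrank_ker π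
    rw [LinearMap.range_eq_top.2 hπ, finrank_top, hkfin, h.finrank_eq] at h1
    omega
  · rw [← map_zero π, hB]
    exact h.zero_mem
  · intro c w hw
    obtain ⟨v, rfl⟩ := hπ w
    rw [← map_smul, hB]
    exact h.smul_mem c v ((hB v).1 hw)
  · have h1 := card_preimage π hπ (fun w => w ∈ B)
    simp only [hB, hkfin, Finset.filter_univ_mem] at h1
    replace h1 : X.card = Fintype.card F ^ (k + 1) * B.card := by
      convert h1
      ext
      simp
    have h2 := h.card_eq hφ h0
    rw [h1, Nat.cast_mul, Nat.cast_pow, hpow] at h2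
    apply mul_left_cancel₀ (mul_pos hu hs).ne'
    linear_combination h2
  · intro ψ hψ
    have h1 := card_preimage π hπ (fun w => w ∈ B ∧ ψ w = 0)
    simp only [hB, hkfin] at h1
    have hne : ψ.comp π ≠ 0 := by
      intro hc
      apply hψ
      ext w
      obtain ⟨v, rfl⟩ := hπ w
      exact LinearMap.congr_fun hc v
    have hmem : ψ.comp π ∈ P := by
      rw [← Subspace.dualCoannihilator_dualAnnihilator_eq (W := P),
        Submodule.mem_dualAnnihilator, ← hker]
      intro v hv
      rw [LinearMap.comp_apply, LinearMap.mem_ker.1 hv, map_zero]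
    have h2 := h.zeros_eq _ hne
    have h3 : zeros X (ψ.comp π) = Fintype.card F ^ (k + 1) * zeros B ψ := by
      have h4 : X.filter (fun v => ψ.comp π v = 0) =
          Finset.univ.filter (fun v => v ∈ X ∧ ψ (π v) = 0) := by ext; simp
      have h5 : B.filter (fun w => ψ w = 0) =
          Finset.univ.filter (fun w => w ∈ B ∧ ψ w = 0) := by ext; simp
      rw [zeros, zeros, h4, h5]
      convert h1
    rw [h3, Nat.cast_mul, Nat.cast_pow, hpow] at h2
    rcases h.values _ hne with h4 | h4 | h4
    · left
      rw [h4] at h2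
      apply mul_left_cancel₀ (mul_pos hu hs).ne'
      linear_combination h2
    · exact absurd h4 ((hP _).1 hmem hne)
    · right
      rw [h4] at h2
      apply mul_left_cancel₀ (mul_pos hu hs).ne'
      linear_combination h2

lemma exists_cone {φ : Dual F V} (hφ : φ ≠ 0) (h0 : f φ = 0) {F₀ : Subfield F}
    (hF₀ : Nat.card F₀ = s) : ∃ (Wv Wb : Submodule F V) (v : Fin 3 → V),
      finrank F Wv = k + 1 ∧ finrank F Wb = 3 ∧ Wv ⊓ Wb = ⊥ ∧ LinearIndependent F v ∧
      (∀ i, v i ∈ Wb) ∧ ∀ x, x ∈ X ↔ ∃ w ∈ Wv, ∃ (a : F) (c : Fin 3 → F), (∀ i, c i ∈ F₀) ∧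
        x = w + a • ∑ i, c i • v i := by
  obtain ⟨P, hP3, hP⟩ := h.exists_dual_plane hφ h0
  let π := P.dualCoannihilator.mkQ
  have hker : LinearMap.ker π = P.dualCoannihilator := Submodule.ker_mkQ _
  have hmem (x : V) : x ∈ P.dualCoannihilator ↔ π x = 0 := by rw [← LinearMap.mem_ker, hker]
  have hπ : Function.Surjective π := Submodule.mkQ_surjective _
  have : Fintype (V ⧸ P.dualCoannihilator) := Fintype.ofFinite _
  have : Finite (Dual F (V ⧸ P.dualCoannihilator)) := Module.finite_of_finite F
  have : Fintype (Dual F (V ⧸ P.dualCoannihilator)) := Fintype.ofFinite _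
  have hB : ∀ v, π v ∈ X.image π ↔ v ∈ X := by
    intro v
    rw [Finset.mem_image]
    refine ⟨?_, fun hv => ⟨v, hv, rfl⟩⟩
    rintro ⟨w, hw, hwv⟩
    have hvw : v - w ∈ P.dualCoannihilator := by rw [hmem, map_sub, hwv, sub_self]
    simpa using h.add_mem_of_mem_dualCoannihilator hφ h0 hP3 hP hw hvw
  have hBaer := h.baerCounts hφ h0 hP3 hP hπ hker hB
  obtain ⟨b, hb⟩ := hBaer.exists_basis_iff hF₀
  obtain ⟨σ, hσ⟩ := π.exists_rightInverse_of_surjective (LinearMap.range_eq_top.2 hπ)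
  have hσ' : ∀ y, π (σ y) = y := fun y => LinearMap.congr_fun hσ y
  have hinj : Function.Injective σ := Function.LeftInverse.injective hσ'
  refine ⟨P.dualCoannihilator, LinearMap.range σ, fun i => σ (b i), ?_, ?_, ?_, ?_, ?_, ?_⟩
  · have h1 := Subspace.finrank_add_finrank_dualCoannihilator_eq P
    have h2 := h.finrank_eq
    omega
  · rw [LinearMap.finrank_range_of_inj hinj, hBaer.finrank_eq]
  · rw [eq_bot_iff]
    rintro _ ⟨hx, y, rfl⟩
    have hy : y = 0 := by
      rw [← hσ' y]
      exact (hmem _).1 hx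
    simp [hy]
  · exact b.linearIndependent.map' σ (LinearMap.ker_eq_bot.2 hinj)
  · exact fun i => ⟨_, rfl⟩
  · intro x
    rw [← hB, hb]
    constructor
    · rintro ⟨a, c, hc, hx⟩
      refine ⟨x - σ (π x), ?_, a, c, hc, ?_⟩
      · rw [hmem, map_sub, hσ', sub_self]
      · rw [hx]
        simp
    · rintro ⟨w, hw, a, c, hc, rfl⟩
      refine ⟨a, c, hc, ?_⟩
      rw [hmem] at hw
      simp [hw, hσ']

end ThreeType
end Main

section Translation

variable {F : Type} [Field F]

/-- The vectors representing the points of `K`, together with `0`. -/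
def vectors [Fintype F] {n : ℕ} (K : Set (PGPoint F n)) : Finset (Fin (n + 1) → F) :=
  Finset.univ.filter (fun v => v = 0 ∨ ∃ h : v ≠ 0, Projectivization.mk F v h ∈ K)

variable [Fintype F] {n : ℕ} {K : Set (PGPoint F n)}

lemma zero_mem_vectors : 0 ∈ vectors K := by simp [vectors]

lemma mem_vectors {v : Fin (n + 1) → F} (hv : v ≠ 0) :
    v ∈ vectors K ↔ Projectivization.mk F v hv ∈ K := by
  simp [vectors, hv]

lemma smul_mem_vectors (c : F) {v : Fin (n + 1) → F} (hv : v ∈ vectors K) :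
    c • v ∈ vectors K := by
  by_cases hc : c = 0
  · simp [hc, zero_mem_vectors]
  by_cases hv0 : v = 0
  · simp [hv0, zero_mem_vectors]
  rw [mem_vectors (smul_ne_zero hc hv0)]
  rw [mem_vectors hv0] at hv
  convert hv using 1
  exact (Projectivization.mk_eq_mk_iff F _ _ _ _).2 ⟨Units.mk0 c hc, rfl⟩

lemma mk_mem_projSet {v : Fin (n + 1) → F} (hv : v ≠ 0) {W : Submodule F (Fin (n + 1) → F)} :
    Projectivization.mk F v hv ∈ projSet F n W ↔ v ∈ W := by
  simp [projSet, Projectivization.submodule_mk, Submodule.span_singleton_le_iff_mem]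

lemma exists_mem_vectors (hblock : BlocksDim F n 1 K) (W : Submodule F (Fin (n + 1) → F))
    (hW : finrank F W = 2) : ∃ v ∈ W, v ≠ 0 ∧ v ∈ vectors K := by
  obtain ⟨x, hxK, hxW⟩ := hblock W hW
  induction x using Projectivization.ind with
  | h v hv => exact ⟨v, (mk_mem_projSet hv).1 hxW, hv, (mem_vectors hv).2 hxK⟩

lemma zeros_vectors (φ : Dual F (Fin (n + 1) → F)) : zeros (vectors K) φ =
    (Fintype.card F - 1) * (K ∩ projSet F n (LinearMap.ker φ)).ncard + 1 := by
  have h1 := card_cone_eq (F := F) (K ∩ projSet F n (LinearMap.ker φ))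
  rw [← h1, zeros]
  have h0 : (0 : Fin (n + 1) → F) ∈ (vectors K).filter (fun v => φ v = 0) := by
    simp [zero_mem_vectors]
  rw [← Finset.card_erase_add_one h0]
  congr 2
  ext v
  simp only [Finset.mem_erase, Finset.mem_filter, Finset.mem_univ, true_and, Set.mem_inter_iff]
  constructor
  · rintro ⟨hv0, hv, hφ⟩
    exact ⟨hv0, (mem_vectors hv0).1 hv, (mk_mem_projSet hv0).2 hφ⟩
  · rintro ⟨hv0, hv, hφ⟩
    exact ⟨hv0, (mem_vectors hv0).2 hv, (mk_mem_projSet hv0).1 hφ⟩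

lemma isBaerCone_of_vectors {F₀ : Subfield F} {k : ℕ} {K : Set (PGPoint F (k + 3))}
    {Wv Wb : Submodule F (Fin (k + 3 + 1) → F)}
    {v : Fin 3 → (Fin (k + 3 + 1) → F)} (hWv : finrank F Wv = k + 1) (hWb : finrank F Wb = 3)
    (hbot : Wv ⊓ Wb = ⊥) (hv : LinearIndependent F v) (hvW : ∀ i, v i ∈ Wb)
    (hX : ∀ x, x ∈ vectors K ↔ ∃ w ∈ Wv, ∃ (a : F) (c : Fin 3 → F), (∀ i, c i ∈ F₀) ∧
      x = w + a • ∑ i, c i • v i) : IsBaerCone F (k + 3) F₀ (k + 1) 2 K := by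
  have hsum (c : Fin 3 → F) : ∑ i, c i • v i ∈ Wb :=
    Submodule.sum_mem _ fun i _ => Submodule.smul_mem _ _ (hvW i)
  have hadd {w y : Fin (k + 3 + 1) → F} (hw : w ∈ Wv) (hy : y ∈ vectors K) :
      w + y ∈ vectors K := by
    obtain ⟨w', hw', a, c, hc, rfl⟩ := (hX y).1 hy
    exact (hX _).2 ⟨w + w', Wv.add_mem hw hw', a, c, hc, (add_assoc _ _ _).symm⟩
  refine ⟨Wv, Wb, hWv, by omega, hbot, ⟨v, hv, ?_⟩, ?_⟩
  · ext x
    induction x using Projectivization.ind with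
    | h x hx =>
      rw [Set.mem_inter_iff, ← mem_vectors, mk_mem_projSet]
      constructor
      · rintro ⟨hxX, hxW⟩
        obtain ⟨w, hw, a, c, hc, rfl⟩ := (hX x).1 hxX
        have hw0 : w = 0 := by
          have hwb : w ∈ Wb := by
            simpa using Wb.sub_mem hxW (Wb.smul_mem a (hsum c))
          have : w ∈ Wv ⊓ Wb := ⟨hw, hwb⟩
          rwa [hbot, Submodule.mem_bot] at this
        subst hw0
        rw [zero_add] at hx
        have ha : a ≠ 0 := (smul_ne_zero_iff.1 hx).1
        refine ⟨c, hc, (smul_ne_zero_iff.1 hx).2, ?_⟩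
        refine (Projectivization.mk_eq_mk_iff F _ _ _ _).2 ⟨Units.mk0 a ha, ?_⟩
        rw [zero_add]
        rfl
      · rintro ⟨c, hc, hne, heq⟩
        obtain ⟨a, rfl⟩ := (Projectivization.mk_eq_mk_iff F _ _ _ _).1 heq
        exact ⟨(hX _).2 ⟨0, Wv.zero_mem, a, c, hc, by rw [zero_add]; rfl⟩,
          Wb.smul_mem _ (hsum c)⟩
  · ext x
    induction x using Projectivization.ind with
    | h x hx =>
      rw [← mem_vectors hx]
      simp only [Set.mem_union, Set.mem_iUnion, Set.mem_inter_iff]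
      constructor
      · intro hxX
        obtain ⟨w, hw, a, c, hc, rfl⟩ := (hX x).1 hxX
        by_cases hy : ∑ i, c i • v i = 0
        · left; left
          rw [mk_mem_projSet, hy, smul_zero, add_zero]
          exact hw
        · have hyK : Projectivization.mk F _ hy ∈ K :=
            (mem_vectors hy).1 ((hX _).2 ⟨0, Wv.zero_mem, 1, c, hc, by simp⟩)
          have hyW : Projectivization.mk F _ hy ∈ projSet F (k + 3) Wb :=
            (mk_mem_projSet hy).2 (hsum c)
          by_cases hw0 : w = 0
          · left; right
            refine ⟨(mem_vectors _).1 hxX, (mk_mem_projSet _).2 ?_⟩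
            rw [hw0, zero_add]
            exact Wb.smul_mem a (hsum c)
          · right
            refine ⟨_, ⟨hyK, hyW⟩, Projectivization.mk F w hw0, (mk_mem_projSet hw0).2 hw, ?_⟩
            rw [mk_mem_projSet, Projectivization.submodule_mk, Projectivization.submodule_mk]
            exact Submodule.add_mem_sup (Submodule.mem_span_singleton_self _)
              (Submodule.smul_mem _ _ (Submodule.mem_span_singleton_self _))
      · rintro ((hxv | ⟨hxK, -⟩) | ⟨y, ⟨hyK, -⟩, z, hz, hxyz⟩)
        · rw [mk_mem_projSet] at hxv
          simpa using hadd hxv zero_mem_vectors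
        · exact (mem_vectors hx).2 hxK
        · induction y using Projectivization.ind with
          | h y hy =>
            induction z using Projectivization.ind with
            | h z hz0 =>
              rw [mk_mem_projSet, Projectivization.submodule_mk, Projectivization.submodule_mk,
                Submodule.mem_sup] at hxyz
              obtain ⟨z', hz', y', hy', rfl⟩ := hxyz
              obtain ⟨a, rfl⟩ := Submodule.mem_span_singleton.1 hz'
              obtain ⟨b, rfl⟩ := Submodule.mem_span_singleton.1 hy'
              exact hadd (Wv.smul_mem a ((mk_mem_projSet hz0).1 hz))
                (smul_mem_vectors b ((mem_vectors hy).2 hyK))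

lemma pred_mul_Cnum_add_one {s : ℕ} (hs : 2 ≤ s) (m t : ℕ) :
    (((s ^ 2 - 1) * Cnum (s ^ 2) s m t + 1 : ℕ) : ℤ) =
      ((s : ℤ) ^ 2 - 1) * (∑ i ∈ Finset.range (t + 1), (s : ℤ) ^ i) * ((s : ℤ) ^ 2) ^ m +
        ((s : ℤ) ^ 2) ^ m := by
  have hs2 : 2 ≤ s ^ 2 := by nlinarith
  rw [Cnum, ← Nat.geomSum_eq hs, ← Nat.geomSum_eq hs2]
  push_cast [Nat.cast_pred (show 0 < s ^ 2 by omega)]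
  have := mul_geom_sum ((s : ℤ) ^ 2) m
  linear_combination this

lemma threeType_vectors {s k : ℕ} (hs : 2 ≤ s) (hF : Fintype.card F = s ^ 2)
    {K : Set (PGPoint F (k + 3))} (hblock : BlocksDim F (k + 3) 1 K)
    (hK : IsType3 F (k + 3) K (Cnum (s ^ 2) s (k + 1) 0) (Cnum (s ^ 2) s k 2)
      (Cnum (s ^ 2) s (k + 1) 1)) :
    ∃ f : Dual F (Fin (k + 3 + 1) → F) → ℤ, ThreeType F (vectors K) f s k ∧
      ∃ φ, φ ≠ 0 ∧ f φ = 0 := by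
  have hs' : (2 : ℤ) ≤ s := by exact_mod_cast hs
  have hD : ((s : ℤ) ^ 2 - 1) * (s : ℤ) ^ (2 * k + 1) ≠ 0 := by
    have : 0 < (s : ℤ) ^ 2 - 1 := by nlinarith
    positivity
  have hfin : finrank F (Fin (k + 3 + 1) → F) = k + 4 := by simp
  have hker {φ : Dual F (Fin (k + 3 + 1) → F)} (hφ : φ ≠ 0) :
      finrank F (LinearMap.ker φ) = k + 3 := by
    have := Module.Dual.finrank_ker_add_one_of_ne_zero hφ
    omega
  let f : Dual F (Fin (k + 3 + 1) → F) → ℤ := fun φ =>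
    ((zeros (vectors K) φ : ℤ) - (s : ℤ) ^ (2 * k + 4)) /
      (((s : ℤ) ^ 2 - 1) * (s : ℤ) ^ (2 * k + 1))
  have hf {φ : Dual F (Fin (k + 3 + 1) → F)} {t : ℤ} (ht : (zeros (vectors K) φ : ℤ) =
      (s : ℤ) ^ (2 * k + 4) + ((s : ℤ) ^ 2 - 1) * (s : ℤ) ^ (2 * k + 1) * t) : f φ = t := by
    simp only [f, ht, add_sub_cancel_left]
    exact Int.mul_ediv_cancel_left t hD
  have ha {φ : Dual F (Fin (k + 3 + 1) → F)} (h : (K ∩ projSet F (k + 3) (LinearMap.ker φ)).ncard =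
      Cnum (s ^ 2) s (k + 1) 0) : (zeros (vectors K) φ : ℤ) =
      (s : ℤ) ^ (2 * k + 4) + ((s : ℤ) ^ 2 - 1) * (s : ℤ) ^ (2 * k + 1) * 0 := by
    rw [zeros_vectors, h, hF, pred_mul_Cnum_add_one hs]
    simp only [Finset.sum_range_succ, Finset.sum_range_zero]
    ring
  have hz : ∀ φ : Dual F (Fin (k + 3 + 1) → F), φ ≠ 0 → ∃ t : ℤ, (t = 0 ∨ t = 1 ∨ t = (s : ℤ) ^ 2) ∧
      (zeros (vectors K) φ : ℤ) =
        (s : ℤ) ^ (2 * k + 4) + ((s : ℤ) ^ 2 - 1) * (s : ℤ) ^ (2 * k + 1) * t := by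
    intro φ hφ
    rcases hK.1 _ (hker hφ) with h | h | h
    · exact ⟨0, Or.inl rfl, ha h⟩
    · refine ⟨1, Or.inr (Or.inl rfl), ?_⟩
      rw [zeros_vectors, h, hF, pred_mul_Cnum_add_one hs]
      simp only [Finset.sum_range_succ, Finset.sum_range_zero]
      ring
    · refine ⟨(s : ℤ) ^ 2, Or.inr (Or.inr rfl), ?_⟩
      rw [zeros_vectors, h, hF, pred_mul_Cnum_add_one hs]
      simp only [Finset.sum_range_succ, Finset.sum_range_zero]
      ring
  refine ⟨f, ⟨hF, hs, hfin, zero_mem_vectors, fun c _ hv => smul_mem_vectors c hv,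
    exists_mem_vectors hblock, fun φ hφ => ?_, fun φ hφ => ?_⟩, ?_⟩
  · obtain ⟨t, -, ht⟩ := hz φ hφ
    rw [hf ht, ht]
  · obtain ⟨t, ht, htz⟩ := hz φ hφ
    rwa [hf htz]
  · obtain ⟨W, hW, hcard⟩ := hK.2.1
    have hlt : W < ⊤ := by
      refine lt_of_le_of_ne le_top fun hc => ?_
      rw [hc, finrank_top] at hW
      omega
    obtain ⟨φ, hφ, hle⟩ := Submodule.exists_le_ker_of_lt_top _ hlt
    have heq := Submodule.eq_of_le_of_finrank_eq hle (by rw [hW, hker hφ])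
    subst heq
    exact ⟨φ, hφ, hf (ha hcard)⟩

end Translation
end BaerCone

/-- In `PG(n,q)`, `n ≥ 3`, `q ≥ 4` a square prime power, every
`(n-1)`-blocking set of type `(C_{n-3,0}, C_{n-4,2}, C_{n-3,1})_{n-1}`, i.e.
`(θ_{n-2}, θ_{n-2} + √q^{2n-5}, θ_{n-2} + √q^{2n-3})_{n-1}`, is an
`(n-3, 2)`-Baer cone. -/
theorem statement5 [Fintype F] (p e q sq n : ℕ) (hp : p.Prime) (he : 0 < e)
    (hqdef : q = p ^ (2 * e)) (hsq : sq = p ^ e) (hq : Fintype.card F = q)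
    (hq4 : 4 ≤ q)
    (F₀ : Subfield F) (hF₀ : Nat.card F₀ = sq)
    (hn : 3 ≤ n)
    (K : Set (PGPoint F n)) (hblock : BlocksDim F n 1 K)
    (hK : IsType3 F n K (Cnum q sq (n - 2) 0) (Cnum q sq (n - 3) 2) (Cnum q sq (n - 2) 1)) :
    IsBaerCone F n F₀ (n - 2) 2 K := by
  subst hsq hqdef
  obtain ⟨k, rfl⟩ : ∃ k, n = k + 3 := ⟨n - 3, by omega⟩
  have hpow : p ^ (2 * e) = (p ^ e) ^ 2 := by rw [← pow_mul, mul_comm]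
  have hs : 2 ≤ p ^ e := hp.two_le.trans (Nat.le_self_pow he.ne' p)
  rw [hpow] at hq hK
  obtain ⟨f, hf, φ, hφ, h0⟩ := BaerCone.threeType_vectors hs hq hblock hK
  have : Finite (Dual F (Fin (k + 3 + 1) → F)) := Module.finite_of_finite F
  have : Fintype (Dual F (Fin (k + 3 + 1) → F)) := Fintype.ofFinite _
  obtain ⟨Wv, Wb, v, hWv, hWb, hbot, hv, hvW, hX⟩ := hf.exists_cone hφ h0 hF₀
  exact BaerCone.isBaerCone_of_vectors hWv hWb hbot hv hvW hX
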